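/- arXiv:1111.3277 — 9 statements merged into one kernel-verified Lean document; each statement's English description precedes it below -/
import Mathlib

section
/- Let G be a simple graph of girth at least 5 and let x₁x₂ and x₃x₄ be two edges of G with x₁, x₂, x₃, x₄ pairwise distinct, such that for all i ≠ j in {1,2,3,4} the neighbourhoods of x_i and x_j in G are disjoint. Let G' be the graph obtained from G by deleting the edges x₁x₂ and x₃x₄, adding one new vertex v, and adding the four edges v x₁, v x₂, v x₃, v x₄. Then G' has girth at least 5. -/
open SimpleGraph

/-- The graph `G'` obtained from `G` by deleting the edges `x₁x₂` and `x₃x₄`, adding one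
new vertex (`none`), and joining the new vertex to `x₁, x₂, x₃, x₄`. -/
def extendGraph {V : Type*} (G : SimpleGraph V) (x₁ x₂ x₃ x₄ : V) :
    SimpleGraph (Option V) :=
  SimpleGraph.fromRel fun v w =>
    match v, w with
    | some a, some b => (G.deleteEdges {s(x₁, x₂), s(x₃, x₄)}).Adj a b
    | none, some b => b = x₁ ∨ b = x₂ ∨ b = x₃ ∨ b = x₄
    | _, _ => False

/-- A graph has girth at least `5` iff it has no triangle and no two distinct vertices have two
distinct common neighbours. -/
theorem SimpleGraph.five_le_egirth_iff {V : Type*} {G : SimpleGraph V} :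
    5 ≤ G.egirth ↔ (∀ a b c, G.Adj a b → G.Adj b c → ¬ G.Adj c a) ∧
      ∀ a b c d, a ≠ c → b ≠ d → G.Adj a b → G.Adj b c → G.Adj c d → ¬ G.Adj d a := by
  rw [le_egirth]
  constructor
  · refine fun h ↦ ⟨fun a b c hab hbc hca ↦ ?_, fun a b c d hac hbd hab hbc hcd hda ↦ ?_⟩
    · have hw : (Walk.cons hab (.cons hbc (.cons hca .nil))).IsCycle := by
        have := hab.ne
        have := hbc.ne
        have := hca.ne
        simp [Walk.cons_isCycle_iff, Walk.cons_isPath_iff]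
        grind
      exact absurd (h _ _ hw) (by simp; decide)
    · have hw : (Walk.cons hab (.cons hbc (.cons hcd (.cons hda .nil)))).IsCycle := by
        have := hab.ne
        have := hbc.ne
        have := hcd.ne
        have := hda.ne
        simp [Walk.cons_isCycle_iff, Walk.cons_isPath_iff]
        grind
      exact absurd (h _ _ hw) (by simp; decide)
  · rintro ⟨h₃, h₄⟩ a w hw
    by_contra! hlt
    have hlt : w.length < 5 := by exact_mod_cast hlt
    have hle := hw.three_le_length
    match w, hw, hlt, hle with
    | .cons hab (.cons hbc (.cons hca .nil)), _, _, _ => exact h₃ _ _ _ hab hbc hca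
    | .cons hab (.cons hbc (.cons hcd (.cons hda .nil))), hw, _, _ =>
      have hp := hw.support_nodup
      simp at hp
      exact h₄ _ _ _ _ (by grind) (by grind) hab hbc hcd hda
    | .cons _ (.cons _ (.cons _ (.cons _ (.cons _ p)))), _, hlt, _ =>
      simp only [Walk.length_cons] at hlt
      omega

section

variable {V : Type*} {G : SimpleGraph V} {x₁ x₂ x₃ x₄ : V}

theorem extendGraph_adj_some_some {a b : V} :
    (extendGraph G x₁ x₂ x₃ x₄).Adj (some a) (some b) ↔
      G.Adj a b ∧ s(a, b) ≠ s(x₁, x₂) ∧ s(a, b) ≠ s(x₃, x₄) := by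
  have := G.ne_of_adj (a := a) (b := b)
  simp only [extendGraph, fromRel_adj, deleteEdges_adj, Set.mem_insert_iff,
    Set.mem_singleton_iff, G.adj_comm b a, Sym2.eq_swap (a := b) (b := a), ne_eq,
    Option.some.injEq]
  tauto

theorem extendGraph_adj_none_some {b : V} :
    (extendGraph G x₁ x₂ x₃ x₄).Adj none (some b) ↔ b ∈ [x₁, x₂, x₃, x₄] := by
  simp [extendGraph]

theorem extendGraph_adj_some_none {b : V} :
    (extendGraph G x₁ x₂ x₃ x₄).Adj (some b) none ↔ b ∈ [x₁, x₂, x₃, x₄] := by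
  rw [adj_comm, extendGraph_adj_none_some]

end

/-- If `G` has girth at least `5`, `x₁x₂` and `x₃x₄` are two edges with `x₁,x₂,x₃,x₄`
pairwise distinct and pairwise disjoint neighbourhoods, then the graph obtained by
deleting those two edges and joining a new vertex to their four endvertices has girth
at least `5`. -/
theorem extendGraph_egirth {V : Type*} (G : SimpleGraph V) (x₁ x₂ x₃ x₄ : V)
    (hG : 5 ≤ G.egirth)
    (h12 : G.Adj x₁ x₂) (h34 : G.Adj x₃ x₄)
    (hdist : [x₁, x₂, x₃, x₄].Pairwise (· ≠ ·))
    (hdisj : ∀ a ∈ [x₁, x₂, x₃, x₄], ∀ b ∈ [x₁, x₂, x₃, x₄], a ≠ b →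
      G.neighborSet a ∩ G.neighborSet b = ∅) :
    5 ≤ (extendGraph G x₁ x₂ x₃ x₄).egirth := by
  obtain ⟨h₃, h₄⟩ := five_le_egirth_iff.1 hG
  have hcommon : ∀ {a b c}, a ∈ [x₁, x₂, x₃, x₄] → b ∈ [x₁, x₂, x₃, x₄] → a ≠ b →
      (extendGraph G x₁ x₂ x₃ x₄).Adj (some a) (some c) →
      ¬ (extendGraph G x₁ x₂ x₃ x₄).Adj (some c) (some b) := fun {a b c} ha hb hab hac hcb ↦
    (hdisj a ha b hb hab).le ⟨(extendGraph_adj_some_some.1 hac).1,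
      (extendGraph_adj_some_some.1 hcb).1.symm⟩
  have hindep : ∀ {a b}, a ∈ [x₁, x₂, x₃, x₄] → b ∈ [x₁, x₂, x₃, x₄] →
      ¬ (extendGraph G x₁ x₂ x₃ x₄).Adj (some a) (some b) := by
    intro a b ha hb hab
    obtain ⟨hadj, h₁₂, h₃₄⟩ := extendGraph_adj_some_some.1 hab
    obtain ⟨c, hc, hbc, hac⟩ : ∃ c ∈ [x₁, x₂, x₃, x₄], G.Adj c b ∧ a ≠ c := by
      have := h12.symm
      have := h34.symm
      have := Sym2.eq_swap (a := x₁) (b := x₂)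
      have := Sym2.eq_swap (a := x₃) (b := x₄)
      simp only [List.mem_cons, List.not_mem_nil, or_false] at hb
      rcases hb with rfl | rfl | rfl | rfl
      · exact ⟨x₂, by simp, by assumption, by grind⟩
      · exact ⟨x₁, by simp, by assumption, by grind⟩
      · exact ⟨x₄, by simp, by assumption, by grind⟩
      · exact ⟨x₃, by simp, by assumption, by grind⟩
    exact (hdisj a ha c hc hac).le ⟨hadj, hbc⟩
  refine five_le_egirth_iff.2 ⟨?_, ?_⟩
  · rintro (_ | a) (_ | b) (_ | c) hab hbc hca
    all_goals first
      | exact hab.ne rfl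
      | exact hbc.ne rfl
      | exact hca.ne rfl
      | skip
    · exact hindep (extendGraph_adj_none_some.1 hab) (extendGraph_adj_some_none.1 hca) hbc
    · exact hindep (extendGraph_adj_none_some.1 hbc) (extendGraph_adj_some_none.1 hab) hca
    · exact hindep (extendGraph_adj_none_some.1 hca) (extendGraph_adj_some_none.1 hbc) hab
    · exact h₃ a b c (extendGraph_adj_some_some.1 hab).1 (extendGraph_adj_some_some.1 hbc).1
        (extendGraph_adj_some_some.1 hca).1
  · rintro (_ | a) (_ | b) (_ | c) (_ | d) hac hbd hab hbc hcd hda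
    all_goals first
      | exact hac rfl
      | exact hbd rfl
      | exact hab.ne rfl
      | exact hbc.ne rfl
      | exact hcd.ne rfl
      | exact hda.ne rfl
      | skip
    · exact hcommon (extendGraph_adj_none_some.1 hab) (extendGraph_adj_some_none.1 hda)
        (by simpa using hbd) hbc hcd
    · exact hcommon (extendGraph_adj_none_some.1 hbc) (extendGraph_adj_some_none.1 hab)
        (by simpa using hac.symm) hcd hda
    · exact hcommon (extendGraph_adj_none_some.1 hcd) (extendGraph_adj_some_none.1 hbc)
        (by simpa using hbd.symm) hda hab
    · exact hcommon (extendGraph_adj_none_some.1 hda) (extendGraph_adj_some_none.1 hcd)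
        (by simpa using hac) hab hbc
    · exact h₄ a b c d (by simpa using hac) (by simpa using hbd)
        (extendGraph_adj_some_some.1 hab).1 (extendGraph_adj_some_some.1 hbc).1
        (extendGraph_adj_some_some.1 hcd).1 (extendGraph_adj_some_some.1 hda).1
end

section
/- For every natural number n ≥ 5, the graph H₁(n) is 3-regular and has girth exactly 5. -/
open SimpleGraph

/-- The graph `H₁(n)` on `ZMod (3n) ⊕ ZMod (3n)`: the left vertices form a cycle of
length `3n` (step-1 circulant), the right vertices form a step-2 circulant, and each
left vertex `a` is matched to the right vertex `a`. -/
def H1 (n : ℕ) : SimpleGraph (ZMod (3 * n) ⊕ ZMod (3 * n)) :=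
  SimpleGraph.fromRel fun v w =>
    match v, w with
    | Sum.inl a, Sum.inl b => b - a = 1
    | Sum.inr a, Sum.inr b => b - a = 2
    | Sum.inl a, Sum.inr b => b = a
    | _, _ => False

namespace H1

variable {n : ℕ}

/-- Numerals between `1` and `14` are nonzero in `ZMod (3 * n)`. -/
lemma natCast_ne_zero (hn : 5 ≤ n) {k : ℕ} (hk : 0 < k) (hk' : k < 15) :
    (k : ZMod (3 * n)) ≠ 0 := by
  rw [Ne, ZMod.natCast_eq_zero_iff]
  intro h
  have := Nat.le_of_dvd hk h
  omega

lemma numerals_ne_zero (hn : 5 ≤ n) :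
    (1 : ZMod (3 * n)) ≠ 0 ∧ (2 : ZMod (3 * n)) ≠ 0 ∧ (3 : ZMod (3 * n)) ≠ 0 ∧
      (4 : ZMod (3 * n)) ≠ 0 ∧ (6 : ZMod (3 * n)) ≠ 0 ∧ (8 : ZMod (3 * n)) ≠ 0 := by
  refine ⟨?_, ?_, ?_, ?_, ?_, ?_⟩
  · exact_mod_cast natCast_ne_zero hn (k := 1) (by norm_num) (by norm_num)
  · exact_mod_cast natCast_ne_zero hn (k := 2) (by norm_num) (by norm_num)
  · exact_mod_cast natCast_ne_zero hn (k := 3) (by norm_num) (by norm_num)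
  · exact_mod_cast natCast_ne_zero hn (k := 4) (by norm_num) (by norm_num)
  · exact_mod_cast natCast_ne_zero hn (k := 6) (by norm_num) (by norm_num)
  · exact_mod_cast natCast_ne_zero hn (k := 8) (by norm_num) (by norm_num)

lemma adj_inl_inl (hn : 5 ≤ n) {a b : ZMod (3 * n)} :
    (H1 n).Adj (Sum.inl a) (Sum.inl b) ↔ b = a + 1 ∨ b = a - 1 := by
  have := numerals_ne_zero hn
  simp only [H1, fromRel_adj, ne_eq, Sum.inl.injEq]
  grind

lemma adj_inr_inr (hn : 5 ≤ n) {a b : ZMod (3 * n)} :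
    (H1 n).Adj (Sum.inr a) (Sum.inr b) ↔ b = a + 2 ∨ b = a - 2 := by
  have := numerals_ne_zero hn
  simp only [H1, fromRel_adj, ne_eq, Sum.inr.injEq]
  grind

lemma adj_inl_inr {a b : ZMod (3 * n)} :
    (H1 n).Adj (Sum.inl a) (Sum.inr b) ↔ b = a := by
  simp [H1]

lemma adj_inr_inl {a b : ZMod (3 * n)} :
    (H1 n).Adj (Sum.inr a) (Sum.inl b) ↔ b = a := by
  simp [H1, eq_comm]

lemma neighborSet_inl (hn : 5 ≤ n) (a : ZMod (3 * n)) :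
    (H1 n).neighborSet (Sum.inl a) = {Sum.inl (a + 1), Sum.inl (a - 1), Sum.inr a} := by
  ext (b | b) <;> simp [adj_inl_inl hn, adj_inl_inr]

lemma neighborSet_inr (hn : 5 ≤ n) (a : ZMod (3 * n)) :
    (H1 n).neighborSet (Sum.inr a) = {Sum.inr (a + 2), Sum.inr (a - 2), Sum.inl a} := by
  ext (b | b) <;> simp [adj_inr_inr hn, adj_inr_inl]

lemma ncard_neighborSet (hn : 5 ≤ n) (v : ZMod (3 * n) ⊕ ZMod (3 * n)) :
    ((H1 n).neighborSet v).ncard = 3 := by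
  obtain ⟨-, h2, -, h4, -⟩ := numerals_ne_zero hn
  rw [Set.ncard_eq_three]
  rcases v with a | a
  · refine ⟨_, _, _, fun h ↦ h2 ?_, by simp, by simp, neighborSet_inl hn a⟩
    linear_combination Sum.inl_injective h
  · refine ⟨_, _, _, fun h ↦ h4 ?_, by simp, by simp, neighborSet_inr hn a⟩
    linear_combination Sum.inr_injective h

/-- The adjacencies expressed through a step `t` (namely `t = 1`) kept as a variable. -/
lemma exists_step (hn : 5 ≤ n) :
    ∃ t : ZMod (3 * n),
      (∀ a b, (H1 n).Adj (Sum.inl a) (Sum.inl b) ↔ b = a + t ∨ b = a - t) ∧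
      (∀ a b, (H1 n).Adj (Sum.inr a) (Sum.inr b) ↔ b = a + 2 * t ∨ b = a - 2 * t) ∧
      t ≠ 0 ∧ 2 * t ≠ 0 ∧ 3 * t ≠ 0 ∧ 4 * t ≠ 0 ∧ 6 * t ≠ 0 ∧ 8 * t ≠ 0 :=
  ⟨1, fun _ _ ↦ adj_inl_inl hn, by simpa using fun _ _ ↦ adj_inr_inr hn,
    by simpa using numerals_ne_zero hn⟩

lemma not_triangle (hn : 5 ≤ n) {u v w : ZMod (3 * n) ⊕ ZMod (3 * n)}
    (huv : (H1 n).Adj u v) (hvw : (H1 n).Adj v w) (hwu : (H1 n).Adj w u) : False := by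
  obtain ⟨t, hl, hr, ht⟩ := exists_step hn
  rcases u with u | u <;> rcases v with v | v <;> rcases w with w | w <;>
    simp only [hl, hr, adj_inl_inr, adj_inr_inl] at huv hvw hwu <;>
    clear hl hr <;> grind

lemma not_square (hn : 5 ≤ n) {u v w x : ZMod (3 * n) ⊕ ZMod (3 * n)}
    (huv : (H1 n).Adj u v) (hvw : (H1 n).Adj v w) (hwx : (H1 n).Adj w x)
    (hxu : (H1 n).Adj x u) (huw : u ≠ w) (hvx : v ≠ x) : False := by
  obtain ⟨t, hl, hr, ht⟩ := exists_step hn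
  rcases u with u | u <;> rcases v with v | v <;> rcases w with w | w <;> rcases x with x | x <;>
    simp only [hl, hr, adj_inl_inr, adj_inr_inl, ne_eq, Sum.inl.injEq, Sum.inr.injEq]
      at huv hvw hwx hxu huw hvx <;>
    clear hl hr <;> grind

lemma five_le_length (hn : 5 ≤ n) {u : ZMod (3 * n) ⊕ ZMod (3 * n)} {p : (H1 n).Walk u u}
    (hp : p.IsCycle) : 5 ≤ p.length := by
  have h3 := hp.three_le_length
  have hnd := hp.support_nodup
  by_contra! h
  match p with
  | .nil => simp at h3
  | .cons _ .nil => simp at h3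
  | .cons _ (.cons _ .nil) => simp at h3
  | .cons h₁ (.cons h₂ (.cons h₃ .nil)) => exact not_triangle hn h₁ h₂ h₃
  | .cons h₁ (.cons h₂ (.cons h₃ (.cons h₄ .nil))) =>
    simp only [Walk.support_cons, Walk.support_nil, List.tail_cons, List.nodup_cons,
      List.mem_cons, not_or] at hnd
    exact not_square hn h₁ h₂ h₃ h₄ (Ne.symm hnd.2.1.2.1) hnd.1.2.1
  | .cons _ (.cons _ (.cons _ (.cons _ (.cons _ _)))) =>
    simp only [Walk.length_cons] at h
    omega

lemma exists_isCycle_length_eq_five (hn : 5 ≤ n) :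
    ∃ (u : ZMod (3 * n) ⊕ ZMod (3 * n)) (p : (H1 n).Walk u u), p.IsCycle ∧ p.length = 5 := by
  have := numerals_ne_zero hn
  have h₁ : (H1 n).Adj (.inl 0) (.inl 1) := by simp [adj_inl_inl hn]
  have h₂ : (H1 n).Adj (.inl 1) (.inl 2) := by rw [adj_inl_inl hn]; grind
  have h12 : (1 : ZMod (3 * n)) ≠ 2 := by simpa using h₂.ne
  have h₃ : (H1 n).Adj (.inl 2) (.inr 2) := by simp [adj_inl_inr]
  have h₄ : (H1 n).Adj (.inr 2) (.inr 0) := by simp [adj_inr_inr hn]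
  have h₅ : (H1 n).Adj (.inr 0) (.inl 0) := by simp [adj_inr_inl]
  refine ⟨_, .cons h₁ (.cons h₂ (.cons h₃ (.cons h₄ (.cons h₅ .nil)))), ?_, rfl⟩
  rw [Walk.cons_isCycle_iff, Walk.isPath_def]
  constructor
  · simp only [Walk.support_cons, Walk.support_nil]
    grind
  · simp only [Walk.edges_cons, Walk.edges_nil]
    grind

end H1

/-- For `n ≥ 5`, the graph `H₁(n)` is `3`-regular and has girth exactly `5`. -/
theorem H1_regular_girth (n : ℕ) (hn : 5 ≤ n) :
    (∀ v, ((H1 n).neighborSet v).ncard = 3) ∧ (H1 n).egirth = 5 := by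
  refine ⟨H1.ncard_neighborSet hn, le_antisymm ?_ ?_⟩
  · obtain ⟨u, p, hp, hlen⟩ := H1.exists_isCycle_length_eq_five hn
    simpa [hlen] using egirth_le_length hp
  · exact le_egirth.2 fun _ _ hp ↦ by exact_mod_cast H1.five_le_length hn hp
end

section
/- For every natural number n ≥ 5, the graph H₂(n) is 3-regular and has girth at least 5. -/
open SimpleGraph

/-- The graph `H₂(n)` on `ZMod (3n) ⊕ ZMod (3n)`: the left vertices form a step-3
circulant, the right vertices form a step-4 circulant, and each left vertex `a` is
joined to the right vertex `a + 4`. -/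
def H2 (n : ℕ) : SimpleGraph (ZMod (3 * n) ⊕ ZMod (3 * n)) :=
  SimpleGraph.fromRel fun v w =>
    match v, w with
    | Sum.inl a, Sum.inl b => b - a = 3
    | Sum.inr a, Sum.inr b => b - a = 4
    | Sum.inl a, Sum.inr b => b = a + 4
    | _, _ => False

lemma zmod_natCast_ne_zero {n k : ℕ} (hn : 5 ≤ n) (hk : 0 < k ∧ k ≤ 16 ∧ k ≠ 15) :
    (k : ZMod (3 * n)) ≠ 0 := by
  rw [ne_eq, ZMod.natCast_eq_zero_iff]
  rintro ⟨m, hm⟩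
  obtain _ | _ | m := m
  · omega
  · omega
  · nlinarith [Nat.zero_le (n * m)]

lemma H2_adj_inl_inl {n : ℕ} (hn : 5 ≤ n) (a b : ZMod (3 * n)) :
    (H2 n).Adj (Sum.inl a) (Sum.inl b) ↔ b = a + 3 ∨ b = a - 3 := by
  have h3 := zmod_natCast_ne_zero hn (k := 3) (by decide)
  simp only [H2, SimpleGraph.fromRel_adj, ne_eq, Sum.inl.injEq]
  push_cast at h3
  grind

lemma H2_adj_inr_inr {n : ℕ} (hn : 5 ≤ n) (a b : ZMod (3 * n)) :
    (H2 n).Adj (Sum.inr a) (Sum.inr b) ↔ b = a + 4 ∨ b = a - 4 := by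
  have h4 := zmod_natCast_ne_zero hn (k := 4) (by decide)
  simp only [H2, SimpleGraph.fromRel_adj, ne_eq, Sum.inr.injEq]
  push_cast at h4
  grind

lemma H2_adj_inl_inr {n : ℕ} (a b : ZMod (3 * n)) :
    (H2 n).Adj (Sum.inl a) (Sum.inr b) ↔ b = a + 4 := by
  simp [H2]

lemma H2_adj_inr_inl {n : ℕ} (a b : ZMod (3 * n)) :
    (H2 n).Adj (Sum.inr a) (Sum.inl b) ↔ b = a - 4 := by
  rw [SimpleGraph.adj_comm, H2_adj_inl_inr, eq_sub_iff_add_eq, eq_comm]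

lemma H2_ncard_neighborSet {n : ℕ} (hn : 5 ≤ n) (v : ZMod (3 * n) ⊕ ZMod (3 * n)) :
    ((H2 n).neighborSet v).ncard = 3 := by
  have h6 := zmod_natCast_ne_zero hn (k := 6) (by decide)
  have h8 := zmod_natCast_ne_zero hn (k := 8) (by decide)
  push_cast at h6 h8
  rw [Set.ncard_eq_three]
  rcases v with a | a
  · refine ⟨Sum.inl (a + 3), Sum.inl (a - 3), Sum.inr (a + 4), ?_, by simp, by simp, ?_⟩
    · rw [ne_eq, Sum.inl.injEq]
      exact fun h => h6 (by linear_combination h)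
    · ext (b | b) <;> simp [H2_adj_inl_inl hn, H2_adj_inl_inr]
  · refine ⟨Sum.inr (a + 4), Sum.inr (a - 4), Sum.inl (a - 4), ?_, by simp, by simp, ?_⟩
    · rw [ne_eq, Sum.inr.injEq]
      exact fun h => h8 (by linear_combination h)
    · ext (b | b) <;> simp [H2_adj_inr_inr hn, H2_adj_inr_inl]

lemma H2_not_triangle {n : ℕ} (hn : 5 ≤ n) (u v w : ZMod (3 * n) ⊕ ZMod (3 * n))
    (huv : (H2 n).Adj u v) (hvw : (H2 n).Adj v w) (hwu : (H2 n).Adj w u) : False := by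
  have h3 := zmod_natCast_ne_zero hn (k := 3) (by decide)
  have h4 := zmod_natCast_ne_zero hn (k := 4) (by decide)
  have h9 := zmod_natCast_ne_zero hn (k := 9) (by decide)
  have h12 := zmod_natCast_ne_zero hn (k := 12) (by decide)
  push_cast at h3 h4 h9 h12
  rcases u with a | a <;> rcases v with b | b <;> rcases w with c | c <;>
    simp only [H2_adj_inl_inl hn, H2_adj_inr_inr hn, H2_adj_inl_inr, H2_adj_inr_inl]
      at huv hvw hwu <;>
    grind

lemma H2_not_square {n : ℕ} (hn : 5 ≤ n) (u v w x : ZMod (3 * n) ⊕ ZMod (3 * n))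
    (huv : (H2 n).Adj u v) (hvw : (H2 n).Adj v w) (hwx : (H2 n).Adj w x)
    (hxu : (H2 n).Adj x u) (huw : u ≠ w) (hvx : v ≠ x) : False := by
  have h1 := zmod_natCast_ne_zero hn (k := 1) (by decide)
  have h6 := zmod_natCast_ne_zero hn (k := 6) (by decide)
  have h7 := zmod_natCast_ne_zero hn (k := 7) (by decide)
  have h8 := zmod_natCast_ne_zero hn (k := 8) (by decide)
  have h12 := zmod_natCast_ne_zero hn (k := 12) (by decide)
  have h16 := zmod_natCast_ne_zero hn (k := 16) (by decide)
  push_cast at h1 h6 h7 h8 h12 h16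
  rcases u with a | a <;> rcases v with b | b <;> rcases w with c | c <;>
    rcases x with d | d <;>
    simp only [H2_adj_inl_inl hn, H2_adj_inr_inr hn, H2_adj_inl_inr, H2_adj_inr_inl, ne_eq,
      Sum.inl.injEq, Sum.inr.injEq] at huv hvw hwx hxu huw hvx <;>
    grind

/-- For `n ≥ 5`, the graph `H₂(n)` is `3`-regular and has girth at least `5`. -/
theorem H2_regular_girth (n : ℕ) (hn : 5 ≤ n) :
    (∀ v, ((H2 n).neighborSet v).ncard = 3) ∧ 5 ≤ (H2 n).egirth := by
  refine ⟨H2_ncard_neighborSet hn, ?_⟩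
  rw [SimpleGraph.le_egirth]
  intro u c hc
  by_contra hlt
  have hlen : c.length < 5 := by exact_mod_cast not_le.mp hlt
  have h3 := hc.three_le_length
  have hnd := hc.support_nodup
  match c with
  | .nil => simp at h3
  | .cons _ .nil => simp at h3
  | .cons _ (.cons _ .nil) => simp at h3
  | .cons huv (.cons hvw (.cons hwu .nil)) => exact H2_not_triangle hn _ _ _ huv hvw hwu
  | .cons huv (.cons hvw (.cons hwx (.cons hxu .nil))) =>
    simp only [SimpleGraph.Walk.support_cons, SimpleGraph.Walk.support_nil, List.tail_cons,
      List.nodup_cons, List.mem_cons, not_or] at hnd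
    exact H2_not_square hn _ _ _ _ huv hvw hwx hxu (Ne.symm hnd.2.1.2.1) hnd.1.2.1
  | .cons _ (.cons _ (.cons _ (.cons _ (.cons _ _)))) =>
    simp only [SimpleGraph.Walk.length_cons] at hlen
    omega
end

section
/- For every natural number n ≥ 3, the graph H₁'(n) is 3-regular and has girth exactly 5. -/
open SimpleGraph

/-- The graph `H₁'(n)` on `ZMod (3n+2) ⊕ ZMod (3n+2)`: the left vertices form a cycle
of length `3n+2` (step-1 circulant), the right vertices form a step-2 circulant, and
each left vertex `a` is matched to the right vertex `a`. -/
def H1' (n : ℕ) : SimpleGraph (ZMod (3 * n + 2) ⊕ ZMod (3 * n + 2)) :=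
  SimpleGraph.fromRel fun v w =>
    match v, w with
    | Sum.inl a, Sum.inl b => b - a = 1
    | Sum.inr a, Sum.inr b => b - a = 2
    | Sum.inl a, Sum.inr b => b = a
    | _, _ => False

theorem ZMod.natCast_ne_zero_of_lt {m k : ℕ} (hk : 0 < k) (hkm : k < m) : (k : ZMod m) ≠ 0 := by
  rw [Ne, ZMod.natCast_eq_zero_iff]
  exact Nat.not_dvd_of_pos_of_lt hk hkm

/-- A graph without triangles and without `4`-cycles has extended girth at least `5`. -/
theorem SimpleGraph.five_le_egirth {V : Type*} {G : SimpleGraph V}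
    (h₃ : ∀ u v w, G.Adj u v → G.Adj v w → ¬ G.Adj w u)
    (h₄ : ∀ u v w x, u ≠ w → v ≠ x → G.Adj u v → G.Adj v w → G.Adj w x → ¬ G.Adj x u) :
    5 ≤ G.egirth := by
  rw [SimpleGraph.le_egirth]
  intro a p hp
  have h := hp.three_le_length
  have hnd := hp.support_nodup
  norm_cast
  by_contra! hlt
  match p with
  | .nil => simp at h
  | .cons _ .nil => simp at h
  | .cons _ (.cons _ .nil) => simp at h
  | .cons h1 (.cons h2 (.cons h3 .nil)) => exact h₃ _ _ _ h1 h2 h3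
  | .cons h1 (.cons h2 (.cons h3 (.cons h4 .nil))) =>
    simp only [Walk.support_cons, Walk.support_nil, List.tail_cons, List.nodup_cons,
      List.mem_cons, not_or] at hnd
    exact h₄ _ _ _ _ (fun e ↦ hnd.2.1.2.1 e.symm) hnd.1.2.1 h1 h2 h3 h4
  | .cons _ (.cons _ (.cons _ (.cons _ (.cons _ _)))) =>
    simp only [Walk.length_cons] at hlt
    omega

namespace H1Prime

variable {n : ℕ}

theorem adj_inl_inl {a b : ZMod (3 * n + 2)} :
    (H1' n).Adj (.inl a) (.inl b) ↔ b = a + 1 ∨ b = a - 1 := by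
  have h1 : (1 : ZMod (3 * n + 2)) ≠ 0 := by
    simpa using ZMod.natCast_ne_zero_of_lt (m := 3 * n + 2) one_pos (by omega)
  simp only [H1', SimpleGraph.fromRel_adj, ne_eq, Sum.inl.injEq]
  grind

theorem adj_inr_inr (hn : 1 ≤ n) {a b : ZMod (3 * n + 2)} :
    (H1' n).Adj (.inr a) (.inr b) ↔ b = a + 2 ∨ b = a - 2 := by
  have h2 : (2 : ZMod (3 * n + 2)) ≠ 0 := by
    simpa using ZMod.natCast_ne_zero_of_lt (m := 3 * n + 2) two_pos (by omega)
  simp only [H1', SimpleGraph.fromRel_adj, ne_eq, Sum.inr.injEq]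
  grind

theorem adj_inl_inr {a b : ZMod (3 * n + 2)} : (H1' n).Adj (.inl a) (.inr b) ↔ b = a := by
  simp [H1', SimpleGraph.fromRel_adj]

theorem adj_inr_inl {a b : ZMod (3 * n + 2)} : (H1' n).Adj (.inr a) (.inl b) ↔ b = a := by
  rw [SimpleGraph.adj_comm, adj_inl_inr, eq_comm]

theorem neighborSet_inl (a : ZMod (3 * n + 2)) :
    (H1' n).neighborSet (.inl a) = {.inl (a + 1), .inl (a - 1), .inr a} := by
  ext (b | b) <;> simp [adj_inl_inl, adj_inl_inr]

theorem neighborSet_inr (hn : 1 ≤ n) (a : ZMod (3 * n + 2)) :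
    (H1' n).neighborSet (.inr a) = {.inr (a + 2), .inr (a - 2), .inl a} := by
  ext (b | b) <;> simp [adj_inr_inr hn, adj_inr_inl]

theorem ncard_neighborSet (hn : 1 ≤ n) (v : ZMod (3 * n + 2) ⊕ ZMod (3 * n + 2)) :
    ((H1' n).neighborSet v).ncard = 3 := by
  have h2 : (2 : ZMod (3 * n + 2)) ≠ 0 := by
    simpa using ZMod.natCast_ne_zero_of_lt (m := 3 * n + 2) two_pos (by omega)
  have h4 : (4 : ZMod (3 * n + 2)) ≠ 0 := by
    simpa using ZMod.natCast_ne_zero_of_lt (m := 3 * n + 2) four_pos (by omega)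
  rw [Set.ncard_eq_three]
  rcases v with a | a
  · refine ⟨_, _, _, ?_, by simp, by simp, neighborSet_inl a⟩
    rw [Ne, Sum.inl.injEq]
    exact fun h ↦ h2 (by linear_combination h)
  · refine ⟨_, _, _, ?_, by simp, by simp, neighborSet_inr hn a⟩
    rw [Ne, Sum.inr.injEq]
    exact fun h ↦ h4 (by linear_combination h)

theorem five_le_egirth (hn : 3 ≤ n) : 5 ≤ (H1' n).egirth := by
  have h (k : ℕ) (hk : 0 < k) (hk' : k < 11) : (k : ZMod (3 * n + 2)) ≠ 0 :=
    ZMod.natCast_ne_zero_of_lt hk (by omega)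
  have h1 := h 1 (by norm_num) (by norm_num)
  have h2 := h 2 (by norm_num) (by norm_num)
  have h3 := h 3 (by norm_num) (by norm_num)
  have h4 := h 4 (by norm_num) (by norm_num)
  have h6 := h 6 (by norm_num) (by norm_num)
  have h8 := h 8 (by norm_num) (by norm_num)
  push_cast at h1 h2 h3 h4 h6 h8
  clear h
  apply SimpleGraph.five_le_egirth
  · rintro (u | u) (v | v) (w | w) <;>
      simp only [adj_inl_inl, adj_inr_inr (by omega : 1 ≤ n), adj_inl_inr, adj_inr_inl] <;>
      grind [left_eq_add, sub_eq_self]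
  · rintro (u | u) (v | v) (w | w) (x | x) <;>
      simp only [adj_inl_inl, adj_inr_inr (by omega : 1 ≤ n), adj_inl_inr, adj_inr_inl, ne_eq,
        Sum.inl.injEq, Sum.inr.injEq] <;>
      grind

theorem egirth_le_five (hn : 1 ≤ n) : (H1' n).egirth ≤ 5 := by
  have h1 : (1 : ZMod (3 * n + 2)) ≠ 0 := by
    simpa using ZMod.natCast_ne_zero_of_lt (m := 3 * n + 2) one_pos (by omega)
  have h2 : (2 : ZMod (3 * n + 2)) ≠ 0 := by
    simpa using ZMod.natCast_ne_zero_of_lt (m := 3 * n + 2) two_pos (by omega)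
  have e1 : (H1' n).Adj (.inl 0) (.inl 1) := adj_inl_inl.2 (by simp)
  have e2 : (H1' n).Adj (.inl 1) (.inl 2) := adj_inl_inl.2 (.inl (by norm_num))
  have e3 : (H1' n).Adj (.inl 2) (.inr 2) := adj_inl_inr.2 rfl
  have e4 : (H1' n).Adj (.inr 2) (.inr 0) := (adj_inr_inr hn).2 (by simp)
  have e5 : (H1' n).Adj (.inr 0) (.inl 0) := adj_inr_inl.2 rfl
  have h12 : (1 : ZMod (3 * n + 2)) ≠ 2 := fun h ↦ h1 (by linear_combination -h)
  have hc : (Walk.cons e1 (.cons e2 (.cons e3 (.cons e4 (.cons e5 .nil))))).IsCycle := by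
    simp [Walk.cons_isCycle_iff, h1, h2, h12, h1.symm, h2.symm]
  simpa using SimpleGraph.egirth_le_length hc

end H1Prime

/-- For `n ≥ 3`, the graph `H₁'(n)` is `3`-regular and has girth exactly `5`. -/
theorem H1'_regular_girth (n : ℕ) (hn : 3 ≤ n) :
    (∀ v, ((H1' n).neighborSet v).ncard = 3) ∧ (H1' n).egirth = 5 :=
  ⟨H1Prime.ncard_neighborSet (by omega),
    le_antisymm (H1Prime.egirth_le_five (by omega)) (H1Prime.five_le_egirth hn)⟩
end

section
/- For every natural number n ≥ 3, the graph H₂'(n) is 3-regular and has girth at least 5. -/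
open SimpleGraph

/-- The graph `H₂'(n)` on `ZMod (3n+2) ⊕ ZMod (3n+2)`: the left vertices form a step-3
circulant, the right vertices form a step-4 circulant, and each left vertex `a` is
joined to the right vertex `a + 4`. -/
def H2' (n : ℕ) : SimpleGraph (ZMod (3 * n + 2) ⊕ ZMod (3 * n + 2)) :=
  SimpleGraph.fromRel fun v w =>
    match v, w with
    | Sum.inl a, Sum.inl b => b - a = 3
    | Sum.inr a, Sum.inr b => b - a = 4
    | Sum.inl a, Sum.inr b => b = a + 4
    | _, _ => False

namespace H2'

lemma natCast_ne_zero_of_not_dvd {m k : ℕ} (h : ¬ m ∣ k) : (k : ZMod m) ≠ 0 :=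
  fun h0 => h ((ZMod.natCast_eq_zero_iff k m).1 h0)

/-- The short relations among the steps `3` and `4` do not hold modulo `3n + 2`. -/
lemma step_relations_ne_zero {n : ℕ} (hn : 3 ≤ n) :
    (1 : ZMod (3 * n + 2)) ≠ 0 ∧ (3 : ZMod (3 * n + 2)) ≠ 0 ∧ (4 : ZMod (3 * n + 2)) ≠ 0 ∧
    (6 : ZMod (3 * n + 2)) ≠ 0 ∧ (7 : ZMod (3 * n + 2)) ≠ 0 ∧ (8 : ZMod (3 * n + 2)) ≠ 0 ∧
    (9 : ZMod (3 * n + 2)) ≠ 0 ∧ (12 : ZMod (3 * n + 2)) ≠ 0 ∧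
    (16 : ZMod (3 * n + 2)) ≠ 0 := by
  have not_dvd_of_lt (k : ℕ) (hk : 0 < k) (hk' : k < 11) : ¬ 3 * n + 2 ∣ k := fun h => by
    have := Nat.le_of_dvd hk h
    omega
  have not_dvd_twelve : ¬ 3 * n + 2 ∣ 12 := fun h => by
    have := Nat.le_of_dvd (by norm_num) h
    have : n ≤ 3 := by omega
    interval_cases n
    omega
  have not_dvd_sixteen : ¬ 3 * n + 2 ∣ 16 := fun h => by
    have := Nat.le_of_dvd (by norm_num) h
    have : n ≤ 4 := by omega
    interval_cases n <;> omega
  refine ⟨?_, ?_, ?_, ?_, ?_, ?_, ?_, ?_, ?_⟩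
  · exact_mod_cast natCast_ne_zero_of_not_dvd (not_dvd_of_lt 1 (by norm_num) (by norm_num))
  · exact_mod_cast natCast_ne_zero_of_not_dvd (not_dvd_of_lt 3 (by norm_num) (by norm_num))
  · exact_mod_cast natCast_ne_zero_of_not_dvd (not_dvd_of_lt 4 (by norm_num) (by norm_num))
  · exact_mod_cast natCast_ne_zero_of_not_dvd (not_dvd_of_lt 6 (by norm_num) (by norm_num))
  · exact_mod_cast natCast_ne_zero_of_not_dvd (not_dvd_of_lt 7 (by norm_num) (by norm_num))
  · exact_mod_cast natCast_ne_zero_of_not_dvd (not_dvd_of_lt 8 (by norm_num) (by norm_num))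
  · exact_mod_cast natCast_ne_zero_of_not_dvd (not_dvd_of_lt 9 (by norm_num) (by norm_num))
  · exact_mod_cast natCast_ne_zero_of_not_dvd not_dvd_twelve
  · exact_mod_cast natCast_ne_zero_of_not_dvd not_dvd_sixteen

variable {n : ℕ}

lemma adj_inl_inl (hn : 3 ≤ n) {a b : ZMod (3 * n + 2)} :
    (H2' n).Adj (Sum.inl a) (Sum.inl b) ↔ b = a + 3 ∨ b = a - 3 := by
  have := step_relations_ne_zero hn
  simp only [H2', fromRel_adj, ne_eq, Sum.inl.injEq]
  grind

lemma adj_inr_inr (hn : 3 ≤ n) {a b : ZMod (3 * n + 2)} :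
    (H2' n).Adj (Sum.inr a) (Sum.inr b) ↔ b = a + 4 ∨ b = a - 4 := by
  have := step_relations_ne_zero hn
  simp only [H2', fromRel_adj, ne_eq, Sum.inr.injEq]
  grind

lemma adj_inl_inr {a b : ZMod (3 * n + 2)} :
    (H2' n).Adj (Sum.inl a) (Sum.inr b) ↔ b = a + 4 := by
  simp [H2', fromRel_adj]

lemma adj_inr_inl {a b : ZMod (3 * n + 2)} :
    (H2' n).Adj (Sum.inr a) (Sum.inl b) ↔ b = a - 4 := by
  rw [adj_comm, adj_inl_inr, eq_sub_iff_add_eq, eq_comm]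

lemma ncard_neighborSet (hn : 3 ≤ n) (v : ZMod (3 * n + 2) ⊕ ZMod (3 * n + 2)) :
    ((H2' n).neighborSet v).ncard = 3 := by
  have := step_relations_ne_zero hn
  rw [Set.ncard_eq_three]
  rcases v with a | a
  · refine ⟨Sum.inl (a + 3), Sum.inl (a - 3), Sum.inr (a + 4), ?_, by simp, by simp, ?_⟩
    · intro h
      have h0 : (6 : ZMod (3 * n + 2)) = 0 := by linear_combination Sum.inl.inj h
      tauto
    · ext (b | b) <;> simp [adj_inl_inl hn, adj_inl_inr]
  · refine ⟨Sum.inr (a + 4), Sum.inr (a - 4), Sum.inl (a - 4), ?_, by simp, by simp, ?_⟩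
    · intro h
      have h0 : (8 : ZMod (3 * n + 2)) = 0 := by linear_combination Sum.inr.inj h
      tauto
    · ext (b | b) <;> simp [adj_inr_inr hn, adj_inr_inl]

lemma not_adj_of_adj_of_adj (hn : 3 ≤ n) {u v w : ZMod (3 * n + 2) ⊕ ZMod (3 * n + 2)}
    (huv : (H2' n).Adj u v) (hvw : (H2' n).Adj v w) : ¬ (H2' n).Adj w u := by
  intro hwu
  have := step_relations_ne_zero hn
  rcases u with a | a <;> rcases v with b | b <;> rcases w with c | c <;>
    simp only [adj_inl_inl hn, adj_inr_inr hn, adj_inl_inr, adj_inr_inl] at huv hvw hwu <;>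
    grind

lemma eq_or_eq_of_adj (hn : 3 ≤ n) {u v w x : ZMod (3 * n + 2) ⊕ ZMod (3 * n + 2)}
    (huv : (H2' n).Adj u v) (hvw : (H2' n).Adj v w) (hwx : (H2' n).Adj w x)
    (hxu : (H2' n).Adj x u) : u = w ∨ v = x := by
  have := step_relations_ne_zero hn
  rcases u with a | a <;> rcases v with b | b <;> rcases w with c | c <;>
    rcases x with d | d <;>
    simp only [adj_inl_inl hn, adj_inr_inr hn, adj_inl_inr, adj_inr_inl, Sum.inl.injEq,
      Sum.inr.injEq, reduceCtorEq, or_false, false_or] at huv hvw hwx hxu ⊢ <;>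
    grind

lemma five_le_egirth (hn : 3 ≤ n) : 5 ≤ (H2' n).egirth := by
  rw [le_egirth]
  intro u p hp
  have h3 := hp.three_le_length
  have hnodup := hp.support_nodup
  norm_cast
  by_contra! h
  match p, h, h3, hnodup with
  | .cons h₁ (.cons h₂ (.cons h₃ .nil)), _, _, _ =>
    exact not_adj_of_adj_of_adj hn h₁ h₂ h₃
  | .cons h₁ (.cons h₂ (.cons h₃ (.cons h₄ .nil))), _, _, hnodup =>
    rcases eq_or_eq_of_adj hn h₁ h₂ h₃ h₄ with rfl | rfl <;> simp at hnodup
  | .nil, _, h3, _ => simp at h3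
  | .cons _ .nil, _, h3, _ => simp at h3
  | .cons _ (.cons _ .nil), _, h3, _ => simp at h3
  | .cons _ (.cons _ (.cons _ (.cons _ (.cons _ _)))), h, _, _ =>
    simp only [Walk.length_cons] at h
    omega

end H2'

/-- For `n ≥ 3`, the graph `H₂'(n)` is `3`-regular and has girth at least `5`. -/
theorem H2'_regular_girth (n : ℕ) (hn : 3 ≤ n) :
    (∀ v, ((H2' n).neighborSet v).ncard = 3) ∧ 5 ≤ (H2' n).egirth :=
  ⟨H2'.ncard_neighborSet hn, H2'.five_le_egirth hn⟩
end

section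
/- Let q be a prime of the form q = 6n + 1 with n ≥ 2. Then for every natural number u with 0 ≤ u ≤ q − 1 there exists a finite simple graph which is (q + 3 − u)-regular, has girth exactly 5, and has exactly 2(q(q − u) − 1) vertices. -/
open SimpleGraph

/-- A graph without triangles and without `4`-cycles. -/
def NoShortCycle {V : Type*} (G : SimpleGraph V) : Prop :=
  (∀ a b c, G.Adj a b → G.Adj b c → ¬ G.Adj a c) ∧
  ∀ a b c d, a ≠ c → b ≠ d → G.Adj a b → G.Adj b c → G.Adj c d → ¬ G.Adj d a

lemma NoShortCycle.comap {V W : Type*} {G : SimpleGraph W} (hG : NoShortCycle G) {f : V → W}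
    (hf : Function.Injective f) : NoShortCycle (G.comap f) :=
  ⟨fun _ _ _ h₁ h₂ h₃ ↦ hG.1 _ _ _ h₁ h₂ h₃,
    fun _ _ _ _ hac hbd h₁ h₂ h₃ h₄ ↦ hG.2 _ _ _ _ (hf.ne hac) (hf.ne hbd) h₁ h₂ h₃ h₄⟩

lemma NoShortCycle.five_le_egirth {V : Type*} {G : SimpleGraph V} (hG : NoShortCycle G) :
    5 ≤ G.egirth := by
  rw [le_egirth]
  intro a w hw
  by_contra hlt
  have h3 := hw.three_le_length
  have hlt' : w.length < 5 := by
    rw [not_le] at hlt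
    exact_mod_cast hlt
  have hnd := hw.support_nodup
  match w, h3, hlt', hnd with
  | .cons h₁ (.cons h₂ (.cons h₃ .nil)), _, _, _ => exact hG.1 _ _ _ h₁ h₂ h₃.symm
  | .cons h₁ (.cons h₂ (.cons h₃ (.cons h₄ .nil))), _, _, hnd =>
    simp only [Walk.support_cons, Walk.support_nil, List.tail_cons, List.nodup_cons,
      List.mem_cons, not_or] at hnd
    exact hG.2 _ _ _ _ (Ne.symm hnd.2.1.2.1) hnd.1.2.1 h₁ h₂ h₃ h₄
  | .cons _ (.cons _ (.cons _ (.cons _ (.cons _ _)))), _, h, _ =>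
    simp only [Walk.length_cons] at h
    omega

lemma egirth_le_five {V : Type*} {G : SimpleGraph V} {a b c d e : V} (hnd : [a, b, c, d, e].Nodup)
    (hab : G.Adj a b) (hbc : G.Adj b c) (hcd : G.Adj c d) (hde : G.Adj d e) (hea : G.Adj e a) :
    G.egirth ≤ 5 := by
  have hw : (Walk.cons hab (.cons hbc (.cons hcd (.cons hde (.cons hea .nil))))).IsCycle := by
    simp only [List.nodup_cons, List.mem_cons, not_or, List.not_mem_nil, not_false_eq_true,
      List.nodup_nil, and_true] at hnd
    rw [Walk.cons_isCycle_iff]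
    simp [Walk.isPath_def]
    grind
  simpa using egirth_le_length hw

/-- The graph on two copies of the affine plane over `F`, with `(x, y)` and `(m, b)` in different
copies adjacent when `y + b = x * m`, and with the graph `G s x` on the vertical line with
abscissa `x` of the copy `s`. -/
def amalgam {F : Type*} [Field F] (G : Bool → F → SimpleGraph F) :
    SimpleGraph (Bool × F × F) where
  Adj v w := (v.1 = w.1 ∧ v.2.1 = w.2.1 ∧ (G v.1 v.2.1).Adj v.2.2 w.2.2) ∨
    (v.1 = !w.1 ∧ v.2.2 + w.2.2 = v.2.1 * w.2.1)
  symm := ⟨by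
    rintro ⟨s, x, y⟩ ⟨t, z, w⟩ (⟨h₁, h₂, h₃⟩ | ⟨h₁, h₂⟩)
    · dsimp only at h₁ h₂ h₃
      subst h₁ h₂
      exact .inl ⟨rfl, rfl, h₃.symm⟩
    · exact .inr ⟨by simp_all, by dsimp only at h₂ ⊢; rw [add_comm, h₂, mul_comm]⟩⟩
  loopless := ⟨by rintro ⟨s, x, y⟩ (⟨_, _, h⟩ | ⟨h, _⟩) <;> simp_all⟩

section amalgam

variable {F : Type*} [Field F] {G : Bool → F → SimpleGraph F}

lemma amalgam_adj_same {s : Bool} {x y z w : F} :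
    (amalgam G).Adj (s, x, y) (s, z, w) ↔ x = z ∧ (G s x).Adj y w := by
  simp [amalgam]

lemma amalgam_adj_not {s : Bool} {x y m b : F} :
    (amalgam G).Adj (s, x, y) (!s, m, b) ↔ y + b = x * m := by
  simp [amalgam]

lemma amalgam_not_adj {s : Bool} {x y m b : F} :
    (amalgam G).Adj (!s, x, y) (s, m, b) ↔ y + b = x * m := by
  simp [amalgam]

lemma noShortCycle_amalgam (hG : ∀ s x, NoShortCycle (G s x))
    (hdisj : ∀ s x m y z, (G s x).Adj y z → ¬ (G (!s) m).Adj (x * m - y) (x * m - z)) :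
    NoShortCycle (amalgam G) := by
  have side : ∀ s t : Bool, s = t ∨ t = !s := by decide
  constructor
  · rintro ⟨s, x, y⟩ ⟨t, x', y'⟩ ⟨r, x'', y''⟩ h₁ h₂ h₃
    obtain rfl | rfl := side s t <;> obtain rfl | rfl := side s r <;>
      simp only [amalgam_adj_same, amalgam_adj_not, amalgam_not_adj] at h₁ h₂ h₃
    · obtain ⟨rfl, h₁⟩ := h₁
      obtain ⟨rfl, h₂⟩ := h₂
      exact (hG _ _).1 _ _ _ h₁ h₂ h₃.2
    · obtain ⟨rfl, h₁⟩ := h₁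
      exact h₁.ne (by linear_combination h₃ - h₂)
    · obtain ⟨rfl, h₃⟩ := h₃
      exact h₃.ne (by linear_combination h₁ - h₂)
    · obtain ⟨rfl, h₂⟩ := h₂
      exact h₂.ne (by linear_combination h₁ - h₃)
  · have cross : ∀ (s : Bool) (x y z m b c : F), (G s x).Adj y z → z + b = x * m →
        (G (!s) m).Adj b c → y + c = x * m → False := by
      intro s x y z m b c h₁ h₂ h₃ h₄
      refine hdisj s x m y z h₁ ?_
      rw [show x * m - y = c by linear_combination -h₄,
        show x * m - z = b by linear_combination -h₂]
      exact h₃.symm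
    rintro ⟨s, x, y⟩ ⟨t, x', y'⟩ ⟨r, x'', y''⟩ ⟨p, x₃, y₃⟩ hac hbd h₁ h₂ h₃ h₄
    obtain rfl | rfl := side s t <;> obtain rfl | rfl := side s r <;>
      obtain rfl | rfl := side s p <;>
      simp only [amalgam_adj_same, amalgam_adj_not, amalgam_not_adj, ne_eq, Prod.mk.injEq,
        true_and] at hac hbd h₁ h₂ h₃ h₄
    · obtain ⟨rfl, h₁⟩ := h₁
      obtain ⟨rfl, h₂⟩ := h₂
      obtain ⟨rfl, h₃⟩ := h₃
      exact (hG _ _).2 _ _ _ _ (fun h ↦ hac ⟨rfl, h⟩) (fun h ↦ hbd ⟨rfl, h⟩) h₁ h₂ h₃ h₄.2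
    · obtain ⟨rfl, -⟩ := h₁
      obtain ⟨rfl, -⟩ := h₂
      exact hac ⟨rfl, by linear_combination h₄ - h₃⟩
    · obtain ⟨rfl, -⟩ := h₁
      obtain ⟨rfl, -⟩ := h₄
      exact hbd ⟨rfl, by linear_combination h₂ - h₃⟩
    · obtain ⟨rfl, h₁⟩ := h₁
      obtain ⟨rfl, h₃⟩ := h₃
      exact cross _ _ _ _ _ _ _ h₁ h₂ h₃ (by linear_combination h₄)
    · obtain ⟨rfl, -⟩ := h₃
      obtain ⟨rfl, -⟩ := h₄
      exact hac ⟨rfl, by linear_combination h₁ - h₂⟩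
    · have key : (x - x'') * (x' - x₃) = 0 := by linear_combination h₂ - h₁ + h₄ - h₃
      rcases mul_eq_zero.1 key with h | h
      · obtain rfl := sub_eq_zero.1 h
        exact hac ⟨rfl, by linear_combination h₁ - h₂⟩
      · obtain rfl := sub_eq_zero.1 h
        exact hbd ⟨rfl, by linear_combination h₁ - h₄⟩
    · obtain ⟨rfl, h₂⟩ := h₂
      obtain ⟨rfl, h₄⟩ := h₄
      exact cross _ _ _ _ _ _ _ h₄.symm (by linear_combination h₃) h₂.symm h₁
    · obtain ⟨rfl, -⟩ := h₂
      obtain ⟨rfl, -⟩ := h₃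
      exact hbd ⟨rfl, by linear_combination h₁ - h₄⟩


/-- The vertices of `amalgam G` with abscissa in `S`, other than the two origins. -/
def amalgamVerts (S : Finset F) : Set (Bool × F × F) :=
  {v | v.2.1 ∈ S ∧ v.2 ≠ 0}

lemma ncard_amalgamVerts [Fintype F] {S : Finset F} (h0 : 0 ∈ S) :
    (amalgamVerts S).ncard = 2 * (Fintype.card F * S.card - 1) := by
  classical
  have : amalgamVerts S =
      ((Finset.univ : Finset Bool) ×ˢ ((S ×ˢ (Finset.univ : Finset F)).erase 0) : Finset _) := by
    ext ⟨s, x, y⟩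
    simp [amalgamVerts, and_comm]
  rw [this, Set.ncard_coe_finset, Finset.card_product, Finset.card_erase_of_mem (by simp [h0])]
  simp [mul_comm]

lemma ncard_neighborSet_induce_amalgam [Fintype F] [DecidableEq F] {S : Finset F} (h0 : 0 ∈ S)
    (hG0 : ∀ s y, ¬ (G s 0).Adj 0 y) {d : ℕ}
    (hd : ∀ s x y, (x, y) ≠ (0 : F × F) →
      ((G s x).neighborSet y).ncard = d + if y = 0 then 1 else 0)
    (v : amalgamVerts S) :
    (((amalgam G).induce (amalgamVerts S)).neighborSet v).ncard = S.card + d := by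
  obtain ⟨⟨s, x, y⟩, hx, hxy⟩ := v
  dsimp only at hx hxy
  have key : Subtype.val '' (((amalgam G).induce (amalgamVerts S)).neighborSet
      ⟨(s, x, y), hx, hxy⟩) = (fun z ↦ (s, x, z)) '' (G s x).neighborSet y ∪
      (fun m ↦ (!s, m, x * m - y)) '' ((S \ if y = 0 then {0} else ∅ : Finset F) : Set F) := by
    ext ⟨t, m, b⟩
    have ht : t = s ∨ t = !s := by
      cases s <;> cases t <;> simp
    simp only [Set.mem_image, mem_neighborSet, comap_adj, Subtype.exists, exists_and_right,
      Set.mem_union, exists_eq_right, Function.Embedding.subtype_apply, Prod.mk.injEq]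
    rcases ht with rfl | rfl
    · simp only [amalgam_adj_same, amalgamVerts, Set.mem_ofPred_eq]
      constructor
      · rintro ⟨_, rfl, h⟩
        exact .inl ⟨b, h, trivial, rfl, rfl⟩
      · rintro (⟨_, h, -, rfl, rfl⟩ | ⟨_, _, h, _⟩)
        · refine ⟨⟨hx, fun h0 ↦ ?_⟩, rfl, h⟩
          simp only [Prod.mk_eq_zero] at h0
          obtain ⟨rfl, rfl⟩ := h0
          exact hG0 t y h.symm
        · simp at h
    · simp only [amalgam_adj_not, amalgamVerts, Set.mem_ofPred_eq]
      constructor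
      · rintro ⟨⟨hm, hmb⟩, h⟩
        refine .inr ⟨m, ?_, trivial, rfl, by linear_combination -h⟩
        split_ifs with hy
        · subst hy
          simp only [Finset.coe_sdiff, Finset.coe_singleton, Set.mem_sdiff, Finset.mem_coe,
            Set.mem_singleton_iff]
          refine ⟨hm, ?_⟩
          rintro rfl
          exact hmb (by simpa using h)
        · simpa using hm
      · rintro (⟨_, _, h, _⟩ | ⟨_, h, -, rfl, rfl⟩)
        · simp at h
        · refine ⟨⟨(Finset.mem_sdiff.1 h).1, fun h0 ↦ ?_⟩, by ring⟩
          simp only [Prod.mk_eq_zero] at h0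
          obtain ⟨rfl, h0⟩ := h0
          have hy : y = 0 := by simpa using h0
          simp [hy] at h
  rw [← Set.ncard_image_of_injective _ Subtype.val_injective, key, Set.ncard_union_eq,
    Set.ncard_image_of_injective, Set.ncard_image_of_injective, hd s x y hxy,
    Set.ncard_coe_finset]
  · split_ifs with hy
    · have := Finset.card_pos.2 ⟨_, h0⟩
      rw [Finset.card_sdiff_of_subset (by simpa using h0)]
      simp
      omega
    · simp [add_comm]
  · intro m m' h
    simpa using (congrArg (·.2.1) h)
  · intro m m' h
    simpa using h
  · rw [Set.disjoint_left]
    rintro _ ⟨z, _, rfl⟩ ⟨m, _, h⟩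
    simp at h

end amalgam

theorem exists_regular_of_blocks {q : ℕ} (hq : q.Prime) (A B : SimpleGraph (ZMod q)) (k : ZMod q)
    (W : Set (ZMod q)) (hk : k ≠ 0) (hA : NoShortCycle A) (hB : NoShortCycle B)
    (hA0 : ∀ y, ¬ A.Adj 0 y) (hA3 : ∀ y ≠ 0, (A.neighborSet y).ncard = 3)
    (hB3 : ∀ y ≠ 0, (B.neighborSet y).ncard = 3) (hB4 : (B.neighborSet 0).ncard = 4)
    (hAW : ∀ y z, A.Adj y z → y - z ∈ W) (hBW : ∀ y z, B.Adj y z → y - z ∈ W)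
    (hW : ∀ w ∈ W, k * w ∉ W)
    (hpath : ∃ y₁ y₂ y₃, A.Adj y₁ y₂ ∧ A.Adj y₂ y₃ ∧ A.Adj (-(k * y₁)) (-(k * y₃)))
    {u : ℕ} (hu : u ≤ q - 1) :
    ∃ (V : Type) (G : SimpleGraph V), Finite V ∧
      (∀ v, (G.neighborSet v).ncard = q + 3 - u) ∧
      G.egirth = 5 ∧
      Nat.card V = 2 * (q * (q - u) - 1) := by
  have : Fact q.Prime := ⟨hq⟩
  have hq0 : 0 < q := hq.pos
  obtain ⟨S, hS0, hS⟩ : ∃ S : Finset (ZMod q), 0 ∈ S ∧ S.card = q - u := by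
    obtain ⟨S, hS, hS'⟩ := Finset.exists_superset_card_eq (s := ({0} : Finset (ZMod q)))
      (n := q - u) (by simp; omega) (by simp [ZMod.card])
    exact ⟨S, by simpa using hS, hS'⟩
  let e : Bool → ZMod q ≃ ZMod q := fun s ↦ if s then Equiv.mulLeft₀ k hk else Equiv.refl _
  let C : ZMod q → SimpleGraph (ZMod q) := fun x ↦ if x = 0 then A else B
  let G : Bool → ZMod q → SimpleGraph (ZMod q) := fun s x ↦ (C x).comap (e s)
  have hCW : ∀ x y z, (C x).Adj y z → y - z ∈ W := by
    intro x y z h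
    dsimp only [C] at h
    split_ifs at h
    exacts [hAW _ _ h, hBW _ _ h]
  have hC : ∀ x, NoShortCycle (C x) := by
    intro x
    dsimp only [C]
    split_ifs
    exacts [hA, hB]
  have hG : NoShortCycle (amalgam G) := by
    refine noShortCycle_amalgam (fun s x ↦ (hC x).comap (e s).injective) ?_
    rintro (_ | _) x m y z h₁ h₂
    · refine hW _ (hCW _ _ _ h₁) ?_
      convert hCW _ _ _ h₂.symm using 1
      simp [e]
      ring
    · refine hW _ (hCW _ _ _ h₂.symm) ?_
      convert hCW _ _ _ h₁ using 1
      simp [e]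
      ring
  refine ⟨amalgamVerts S, (amalgam G).induce _, inferInstance, ?_, ?_, ?_⟩
  · intro v
    rw [ncard_neighborSet_induce_amalgam hS0 (d := 3)]
    · omega
    · intro s y h
      apply hA0 (e s y)
      have : e s 0 = 0 := by cases s <;> simp [e]
      simpa [G, C, this] using h
    · intro s x y hxy
      have : (G s x).neighborSet y = e s ⁻¹' (C x).neighborSet (e s y) := rfl
      rw [this, Set.ncard_preimage_of_injective_subset_range (e s).injective (by simp)]
      have h0 : e s y = 0 ↔ y = 0 := by cases s <;> simp [e, hk]
      by_cases hx : x = 0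
      · have hy : y ≠ 0 := by
          rintro rfl
          exact hxy (by simp [hx])
        simp [C, hx, hy, hA3 _ (h0.not.2 hy)]
      · by_cases hy : y = 0
        · rw [h0.2 hy]
          simp [C, hx, hy, hB4]
        · simp [C, hx, hy, hB3 _ (h0.not.2 hy)]
  · refine le_antisymm ?_ (hG.comap Subtype.val_injective).five_le_egirth
    obtain ⟨y₁, y₂, y₃, h₁₂, h₂₃, h₁₃⟩ := hpath
    have hne : ∀ {y z}, A.Adj y z → y ≠ 0 ∧ z ≠ 0 := by
      rintro y z h
      constructor <;> rintro rfl
      exacts [hA0 _ h, hA0 _ h.symm]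
    have hmem : ∀ {s y}, y ≠ 0 → ((s, 0, y) : Bool × ZMod q × ZMod q) ∈ amalgamVerts S :=
      fun h ↦ ⟨hS0, by simpa using h⟩
    have ne₁ : -y₁ ≠ 0 := neg_ne_zero.2 (hne h₁₂).1
    have ne₃ : -y₃ ≠ 0 := neg_ne_zero.2 (hne h₂₃).2
    refine egirth_le_five (a := ⟨(false, 0, y₁), hmem (hne h₁₂).1⟩)
      (b := ⟨(false, 0, y₂), hmem (hne h₁₂).2⟩) (c := ⟨(false, 0, y₃), hmem (hne h₂₃).2⟩)
      (d := ⟨(true, 0, -y₃), hmem ne₃⟩) (e := ⟨(true, 0, -y₁), hmem ne₁⟩) ?_ ?_ ?_ ?_ ?_ ?_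
    · have h₁ : y₁ ≠ y₃ := by
        rintro rfl
        exact h₁₃.ne rfl
      simp [h₁₂.ne, h₂₃.ne, h₁, h₁.symm]
    · simpa [amalgam, G, C, e] using h₁₂
    · simpa [amalgam, G, C, e] using h₂₃
    · simp [amalgam]
    · simpa [amalgam, G, C, e] using h₁₃.symm
    · simp [amalgam]
  · rw [Nat.card_coe_set_eq, ncard_amalgamVerts hS0, ZMod.card, hS]

/-- The graph on `ZMod q` with the given lists of neighbors. -/
def ofNeighborLists (q : ℕ) (L : List (List ℕ)) : SimpleGraph (ZMod q) where
  Adj y z := y ≠ z ∧ z.val ∈ L.getD y.val [] ∧ y.val ∈ L.getD z.val []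
  symm := ⟨fun _ _ h ↦ ⟨h.1.symm, h.2.2, h.2.1⟩⟩
  loopless := ⟨fun _ h ↦ h.1 rfl⟩

instance (q : ℕ) (L : List (List ℕ)) : DecidableRel (ofNeighborLists q L).Adj :=
  fun y z ↦ inferInstanceAs
    (Decidable (y ≠ z ∧ z.val ∈ L.getD y.val [] ∧ y.val ∈ L.getD z.val []))

lemma noShortCycle_of_forall {V : Type*} {G : SimpleGraph V}
    (h : ∀ a b, G.Adj a b → ∀ c, G.Adj b c → ¬ G.Adj a c ∧
      (a ≠ c → ∀ d, G.Adj c d → b ≠ d → ¬ G.Adj d a)) : NoShortCycle G :=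
  ⟨fun a b c h₁ h₂ ↦ (h a b h₁ c h₂).1,
    fun a b c d hac hbd h₁ h₂ h₃ ↦ (h a b h₁ c h₂).2 hac d h₃ hbd⟩

lemma ncard_neighborSet_eq_card_filter {V : Type*} [Fintype V] (G : SimpleGraph V)
    [DecidableRel G.Adj] (v : V) :
    (G.neighborSet v).ncard = (Finset.univ.filter (G.Adj v)).card := by
  rw [← Set.ncard_coe_finset]
  congr 1
  ext w
  simp

lemma exists_regular_of_neighborLists {q : ℕ} [NeZero q] (hq : q.Prime) (k : ZMod q)
    (W : List ℕ) (LA LB : List (List ℕ)) (hk : k ≠ 0)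
    (hA : ∀ a b, (ofNeighborLists q LA).Adj a b → (a - b).val ∈ W ∧
      ∀ c, (ofNeighborLists q LA).Adj b c → ¬ (ofNeighborLists q LA).Adj a c ∧
      (a ≠ c → ∀ d, (ofNeighborLists q LA).Adj c d → b ≠ d → ¬ (ofNeighborLists q LA).Adj d a))
    (hB : ∀ a b, (ofNeighborLists q LB).Adj a b → (a - b).val ∈ W ∧
      ∀ c, (ofNeighborLists q LB).Adj b c → ¬ (ofNeighborLists q LB).Adj a c ∧
      (a ≠ c → ∀ d, (ofNeighborLists q LB).Adj c d → b ≠ d → ¬ (ofNeighborLists q LB).Adj d a))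
    (hAd : ∀ y, (Finset.univ.filter ((ofNeighborLists q LA).Adj y)).card = if y = 0 then 0 else 3)
    (hBd : ∀ y, (Finset.univ.filter ((ofNeighborLists q LB).Adj y)).card = if y = 0 then 4 else 3)
    (hW : ∀ w : ZMod q, w.val ∈ W → (k * w).val ∉ W)
    (hpath : ∃ y₁ y₂ y₃, (ofNeighborLists q LA).Adj y₁ y₂ ∧ (ofNeighborLists q LA).Adj y₂ y₃ ∧
      (ofNeighborLists q LA).Adj (-(k * y₁)) (-(k * y₃)))
    {u : ℕ} (hu : u ≤ q - 1) :
    ∃ (V : Type) (G : SimpleGraph V), Finite V ∧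
      (∀ v, (G.neighborSet v).ncard = q + 3 - u) ∧
      G.egirth = 5 ∧
      Nat.card V = 2 * (q * (q - u) - 1) := by
  refine exists_regular_of_blocks hq (ofNeighborLists q LA) (ofNeighborLists q LB) k
    {w | w.val ∈ W} hk (noShortCycle_of_forall fun a b h ↦ (hA a b h).2)
    (noShortCycle_of_forall fun a b h ↦ (hB a b h).2) (fun y hy ↦ ?_) (fun y hy ↦ ?_)
    (fun y hy ↦ ?_) ?_ (fun a b h ↦ (hA a b h).1) (fun a b h ↦ (hB a b h).1) hW hpath hu
  · have h := hAd 0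
    rw [if_pos rfl, Finset.card_eq_zero, Finset.filter_eq_empty_iff] at h
    exact h (Finset.mem_univ y) hy
  · rw [ncard_neighborSet_eq_card_filter, hAd, if_neg hy]
  · rw [ncard_neighborSet_eq_card_filter, hBd, if_neg hy]
  · rw [ncard_neighborSet_eq_card_filter, hBd, if_pos rfl]

lemma exists_regular_of_eq_thirteen {u : ℕ} (hu : u ≤ 13 - 1) :
    ∃ (V : Type) (G : SimpleGraph V), Finite V ∧
      (∀ v, (G.neighborSet v).ncard = 13 + 3 - u) ∧
      G.egirth = 5 ∧
      Nat.card V = 2 * (13 * (13 - u) - 1) := by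
  refine exists_regular_of_neighborLists (q := 13) (by norm_num) 2
    [1, 3, 4, 9, 10, 12]
    [[], [2, 4, 5], [1, 3, 11], [2, 6, 12], [1, 7, 8], [1, 6, 9], [3, 5, 7], [4, 6, 10], [4,
      11, 12], [5, 10, 12], [7, 9, 11], [2, 8, 10], [3, 8, 9]]
    [[1, 3, 9, 12], [0, 2, 4], [1, 5, 6], [0, 6, 7], [1, 7, 8], [2, 8, 9], [2, 3, 10], [3, 4,
      11], [4, 5, 12], [0, 5, 10], [6, 9, 11], [7, 10, 12], [0, 8, 11]]
    ?_ ?_ ?_ ?_ ?_ ?_ ⟨2, 1, 4, ?_⟩ hu <;> decide +kernel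

lemma exists_regular_of_eq_nineteen {u : ℕ} (hu : u ≤ 19 - 1) :
    ∃ (V : Type) (G : SimpleGraph V), Finite V ∧
      (∀ v, (G.neighborSet v).ncard = 19 + 3 - u) ∧
      G.egirth = 5 ∧
      Nat.card V = 2 * (19 * (19 - u) - 1) := by
  refine exists_regular_of_neighborLists (q := 19) (by norm_num) 2
    [1, 3, 4, 5, 14, 15, 16, 18]
    [[], [6, 15, 16], [3, 5, 18], [2, 7, 17], [5, 8, 9], [2, 4, 10], [1, 7, 9], [3, 6, 8], [4,
      7, 13], [4, 6, 14], [5, 11, 13], [10, 14, 16], [13, 15, 17], [8, 10, 12], [9, 11, 18],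
      [1, 12, 18], [1, 11, 17], [3, 12, 16], [2, 14, 15]]
    [[1, 3, 4, 18], [0, 6, 16], [7, 16, 18], [0, 7, 17], [0, 5, 9], [4, 6, 10], [1, 5, 11],
      [2, 3, 8], [7, 9, 12], [4, 8, 13], [5, 13, 15], [6, 14, 15], [8, 16, 17], [9, 10, 14],
      [11, 13, 17], [10, 11, 18], [1, 2, 12], [3, 12, 14], [0, 2, 15]]
    ?_ ?_ ?_ ?_ ?_ ?_ ⟨6, 1, 15, ?_⟩ hu <;> decide +kernel

lemma exists_regular_of_eq_thirty_one {u : ℕ} (hu : u ≤ 31 - 1) :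
    ∃ (V : Type) (G : SimpleGraph V), Finite V ∧
      (∀ v, (G.neighborSet v).ncard = 31 + 3 - u) ∧
      G.egirth = 5 ∧
      Nat.card V = 2 * (31 * (31 - u) - 1) := by
  refine exists_regular_of_neighborLists (q := 31) (by norm_num) 3
    [1, 2, 4, 5, 7, 13, 14, 17, 18, 24, 26, 27, 29, 30]
    [[], [2, 3, 15], [1, 9, 19], [1, 5, 17], [6, 18, 30], [3, 6, 19], [4, 5, 13], [8, 9, 20],
      [7, 22, 25], [2, 7, 11], [14, 17, 28], [9, 13, 15], [16, 19, 30], [6, 11, 27], [10, 15,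
      18], [1, 11, 14], [12, 20, 21], [3, 10, 21], [4, 14, 23], [2, 5, 12], [7, 16, 27], [16,
      17, 25], [8, 23, 26], [18, 22, 28], [25, 26, 29], [8, 21, 24], [22, 24, 27], [13, 20,
      26], [10, 23, 29], [24, 28, 30], [4, 12, 29]]
    [[7, 18, 26, 30], [5, 15, 25], [9, 20, 28], [5, 7, 27], [5, 6, 22], [1, 3, 4], [4, 13,
      30], [0, 3, 24], [12, 22, 25], [2, 11, 23], [12, 15, 23], [9, 13, 15], [8, 10, 26], [6,
      11, 18], [16, 18, 19], [1, 10, 11], [14, 17, 20], [16, 21, 30], [0, 13, 14], [14, 21,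
      26], [2, 16, 27], [17, 19, 28], [4, 8, 24], [9, 10, 24], [7, 22, 23], [1, 8, 29], [0,
      12, 19], [3, 20, 29], [2, 21, 29], [25, 27, 28], [0, 6, 17]]
    ?_ ?_ ?_ ?_ ?_ ?_ ⟨17, 10, 28, ?_⟩ hu <;> decide +kernel


lemma noShortCycle_of_injective {V : Type*} {G : SimpleGraph V} {f : V → ℕ}
    (hf : Function.Injective f)
    (h₃ : ∀ a b c, f b < f a → f c < f b → G.Adj a b → G.Adj b c → ¬ G.Adj a c)
    (h₄ : ∀ a b c d, f c < f a → f b < f d → f d < f a →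
      G.Adj a b → G.Adj b c → G.Adj c d → ¬ G.Adj d a) : NoShortCycle G := by
  have key : ∀ a b c d, f b < f a → f c < f a → f d < f a → b ≠ d →
      G.Adj a b → G.Adj b c → G.Adj c d → ¬ G.Adj d a := by
    intro a b c d hb hc hd hbd h₁ h₂ h₃ h
    rcases lt_or_gt_of_ne (hf.ne hbd) with hlt | hlt
    · exact h₄ a b c d hc hlt hd h₁ h₂ h₃ h
    · exact h₄ a d c b hc hlt hb h.symm h₃.symm h₂.symm h₁.symm
  constructor
  · intro a b c hab hbc hac
    rcases lt_or_gt_of_ne (hf.ne hab.ne) with h | h <;>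
      rcases lt_or_gt_of_ne (hf.ne hbc.ne) with h' | h' <;>
      rcases lt_or_gt_of_ne (hf.ne hac.ne) with h'' | h''
    · exact h₃ c b a h' h hbc.symm hab.symm hac.symm
    · omega
    · exact h₃ b c a h' h'' hbc hac.symm hab.symm
    · exact h₃ b a c h h'' hab.symm hac hbc
    · exact h₃ c a b h'' h hac.symm hab hbc.symm
    · exact h₃ a c b h'' h' hac hbc.symm hab
    · omega
    · exact h₃ a b c h h' hab hbc hac
  · intro a b c d hac hbd hab hbc hcd hda
    have nab := hf.ne hab.ne
    have nbc := hf.ne hbc.ne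
    have ncd := hf.ne hcd.ne
    have nda := hf.ne hda.ne
    have nac := hf.ne hac
    have nbd := hf.ne hbd
    have hmax : (f b < f a ∧ f c < f a ∧ f d < f a) ∨ (f c < f b ∧ f d < f b ∧ f a < f b) ∨
        (f d < f c ∧ f a < f c ∧ f b < f c) ∨ (f a < f d ∧ f b < f d ∧ f c < f d) := by
      omega
    rcases hmax with ⟨h₁, h₂, h₃⟩ | ⟨h₁, h₂, h₃⟩ | ⟨h₁, h₂, h₃⟩ | ⟨h₁, h₂, h₃⟩
    · exact key a b c d h₁ h₂ h₃ hbd hab hbc hcd hda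
    · exact key b c d a h₁ h₂ h₃ hac.symm hbc hcd hda hab
    · exact key c d a b h₁ h₂ h₃ hbd.symm hcd hda hab hbc
    · exact key d a b c h₁ h₂ h₃ hac hda hab hbc hcd

/-- Up to orientation, the edges of a cycle on `1, …, q - 1` with chords of length `7`. -/
def CycleRel (q i j : ℕ) : Prop :=
  (1 ≤ i ∧ j = i + 1) ∨ (i = 1 ∧ j = q - 1) ∨ (i % 2 = 1 ∧ j = i + 7) ∨
    (i = 2 ∧ j = q - 6) ∨ (i = 4 ∧ j = q - 4) ∨ (i = 6 ∧ j = q - 2)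

/-- Up to orientation, the edges of the graph obtained from `CycleRel q` by deleting `{1, q - 1}`
and `{4, q - 4}` and joining their endpoints to the new vertex `0`. -/
def SubdividedRel (q i j : ℕ) : Prop :=
  j = i + 1 ∨ (i = 0 ∧ j = q - 1) ∨ (i % 2 = 1 ∧ j = i + 7) ∨
    (i = 2 ∧ j = q - 6) ∨ (i = 6 ∧ j = q - 2) ∨ (i = 0 ∧ j = 4) ∨ (i = 0 ∧ j = q - 4)

/-- The graph on `ZMod q` whose edges are given by a relation between representatives. -/
def valGraph (q : ℕ) (R : ℕ → ℕ → Prop) : SimpleGraph (ZMod q) :=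
  fromRel fun y z ↦ R y.val z.val

section valGraph

variable {q : ℕ}

lemma valGraph_adj {R : ℕ → ℕ → Prop} (hR : ∀ i j, i < q → j < q → R i j → i < j) [NeZero q]
    {y z : ZMod q} : (valGraph q R).Adj y z ↔ R y.val z.val ∨ R z.val y.val := by
  simp only [valGraph, fromRel_adj, ne_eq, and_iff_right_iff_imp]
  rintro h rfl
  have := hR _ _ (ZMod.val_lt y) (ZMod.val_lt y) (h.elim id id)
  omega

lemma valGraph_adj_of_lt {R : ℕ → ℕ → Prop} (hR : ∀ i j, i < q → j < q → R i j → i < j) [NeZero q]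
    {y z : ZMod q} (hyz : y.val < z.val) : (valGraph q R).Adj y z ↔ R y.val z.val := by
  rw [valGraph_adj hR, or_iff_left]
  intro h
  have := hR _ _ (ZMod.val_lt z) (ZMod.val_lt y) h
  omega

lemma noShortCycle_valGraph [NeZero q] {R : ℕ → ℕ → Prop}
    (hR : ∀ i j, i < q → j < q → R i j → i < j)
    (h₃ : ∀ a b c, a < q → b < a → c < b → R b a → R c b → ¬ R c a)
    (h₄ : ∀ a b c d, a < q → c < a → b < d → d < a → R b a → R d a → R b c ∨ R c b →
      R c d ∨ R d c → False) : NoShortCycle (valGraph q R) := by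
  refine noShortCycle_of_injective (ZMod.val_injective q) ?_ ?_
  · intro a b c hb hc h₁ h₂ h
    rw [adj_comm, valGraph_adj_of_lt hR (by omega)] at h₁ h₂ h
    exact h₃ _ _ _ (ZMod.val_lt a) hb hc h₁ h₂ h
  · intro a b c d hc hbd hda h₁ h₂ h₃ h
    rw [adj_comm, valGraph_adj_of_lt hR (by omega)] at h₁
    rw [valGraph_adj_of_lt hR hda] at h
    rw [valGraph_adj hR] at h₂ h₃
    exact h₄ _ _ _ _ (ZMod.val_lt a) hc hbd hda h₁ h h₂ h₃

lemma ncard_neighborSet_of_val [NeZero q] {G : SimpleGraph (ZMod q)} {y : ZMod q} (s : Finset ℕ)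
    (hs : ∀ i ∈ s, i < q) (h : ∀ z, G.Adj y z ↔ z.val ∈ s) :
    (G.neighborSet y).ncard = s.card := by
  have : G.neighborSet y = ZMod.val ⁻¹' (s : Set ℕ) := by
    ext z
    simp [h]
  rw [this, Set.ncard_preimage_of_injective_subset_range (ZMod.val_injective q),
    Set.ncard_coe_finset]
  intro i hi
  exact ⟨i, ZMod.val_natCast_of_lt (hs i hi)⟩

lemma CycleRel.lt (hq : 37 ≤ q) {i j : ℕ} (h : CycleRel q i j) : i < j := by
  unfold CycleRel at h
  omega

lemma SubdividedRel.lt (hq : 37 ≤ q) {i j : ℕ} (h : SubdividedRel q i j) : i < j := by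
  unfold SubdividedRel at h
  omega

lemma noShortCycle_cycleRel (hq : 37 ≤ q) (hodd : q % 2 = 1) :
    NoShortCycle (valGraph q (CycleRel q)) := by
  have : NeZero q := ⟨by omega⟩
  refine noShortCycle_valGraph (fun _ _ _ _ h ↦ h.lt hq) ?_ ?_
  · intro a b c ha hb hc h₁ h₂ h
    unfold CycleRel at h₁ h₂ h
    rcases h₁ with h₁ | h₁ | h₁ | h₁ | h₁ | h₁ <;> omega
  · intro a b c d ha hc hbd hda h₁ h₂ h₃ h₄
    unfold CycleRel at h₁ h₂ h₃ h₄
    rcases h₁ with h₁ | h₁ | h₁ | h₁ | h₁ | h₁ <;>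
      rcases h₂ with h₂ | h₂ | h₂ | h₂ | h₂ | h₂ <;>
      omega

lemma noShortCycle_subdividedRel (hq : 37 ≤ q) (hodd : q % 2 = 1) :
    NoShortCycle (valGraph q (SubdividedRel q)) := by
  have : NeZero q := ⟨by omega⟩
  refine noShortCycle_valGraph (fun _ _ _ _ h ↦ h.lt hq) ?_ ?_
  · intro a b c ha hb hc h₁ h₂ h
    unfold SubdividedRel at h₁ h₂ h
    rcases h₁ with h₁ | h₁ | h₁ | h₁ | h₁ | h₁ | h₁ <;> omega
  · intro a b c d ha hc hbd hda h₁ h₂ h₃ h₄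
    unfold SubdividedRel at h₁ h₂ h₃ h₄
    rcases h₁ with h₁ | h₁ | h₁ | h₁ | h₁ | h₁ | h₁ <;>
      rcases h₂ with h₂ | h₂ | h₂ | h₂ | h₂ | h₂ | h₂ <;>
      omega

lemma ncard_neighborSet_cycleRel (hq : 37 ≤ q) (hodd : q % 2 = 1) {y : ZMod q} (hy : y ≠ 0) :
    ((valGraph q (CycleRel q)).neighborSet y).ncard = 3 := by
  have : NeZero q := ⟨by omega⟩
  have hy₀ : y.val ≠ 0 := by simpa using hy
  have hyq := ZMod.val_lt y
  rw [ncard_neighborSet_of_val {if y.val = q - 1 then 1 else y.val + 1,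
    if y.val = 1 then q - 1 else y.val - 1,
    if y.val % 2 = 1 then (if y.val + 7 < q then y.val + 7 else y.val + 8 - q) else
      (if y.val < 8 then y.val + q - 8 else y.val - 7)}]
  · rw [Finset.card_eq_three]
    exact ⟨_, _, _, by split_ifs <;> omega, by split_ifs <;> omega, by split_ifs <;> omega, rfl⟩
  · simp only [Finset.mem_insert, Finset.mem_singleton]
    rintro i (rfl | rfl | rfl) <;> split_ifs <;> omega
  · intro z
    have hzq := ZMod.val_lt z
    rw [valGraph_adj fun _ _ _ _ h ↦ CycleRel.lt hq h]
    simp only [Finset.mem_insert, Finset.mem_singleton, CycleRel]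
    generalize y.val = i at *
    generalize z.val = j at *
    constructor
    · rintro ((h | h | h | h | h | h) | (h | h | h | h | h | h)) <;> split_ifs <;> omega
    · rintro (h | h | h) <;> split_ifs at h
      · refine .inr (.inr (.inl ?_)); omega
      · refine .inl (.inl ?_); omega
      · refine .inl (.inr (.inl ?_)); omega
      · refine .inr (.inl ?_); omega
      · refine .inl (.inr (.inr (.inl ?_))); omega
      · refine .inr (.inr (.inr (.inr ?_))); omega
      · refine .inl (.inr (.inr (.inr ?_))); omega
      · refine .inr (.inr (.inr (.inl ?_))); omega

lemma ncard_neighborSet_subdividedRel (hq : 37 ≤ q) (hodd : q % 2 = 1) {y : ZMod q}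
    (hy : y ≠ 0) : ((valGraph q (SubdividedRel q)).neighborSet y).ncard = 3 := by
  have : NeZero q := ⟨by omega⟩
  have hy₀ : y.val ≠ 0 := by simpa using hy
  have hyq := ZMod.val_lt y
  rw [ncard_neighborSet_of_val {if y.val = q - 1 then 0 else y.val + 1, y.val - 1,
    if y.val = 4 ∨ y.val = q - 4 then 0 else
    if y.val % 2 = 1 then (if y.val + 7 < q then y.val + 7 else y.val + 8 - q) else
      (if y.val < 8 then y.val + q - 8 else y.val - 7)}]
  · rw [Finset.card_eq_three]
    exact ⟨_, _, _, by split_ifs <;> omega, by split_ifs <;> omega, by split_ifs <;> omega, rfl⟩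
  · simp only [Finset.mem_insert, Finset.mem_singleton]
    rintro i (rfl | rfl | rfl) <;> (try split_ifs) <;> omega
  · intro z
    have hzq := ZMod.val_lt z
    rw [valGraph_adj fun _ _ _ _ h ↦ SubdividedRel.lt hq h]
    simp only [Finset.mem_insert, Finset.mem_singleton, SubdividedRel]
    generalize y.val = i at *
    generalize z.val = j at *
    constructor
    · rintro ((h | h | h | h | h | h | h) | (h | h | h | h | h | h | h)) <;> split_ifs <;> omega
    · rintro (h | h | h)
      · split_ifs at h
        · refine .inr (.inr (.inl ?_)); omega
        · refine .inl (.inl ?_); omega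
      · refine .inr (.inl ?_); omega
      · split_ifs at h with h'
        · rcases h' with h' | h'
          · refine .inr (.inr (.inr (.inr (.inr (.inr (.inl ?_)))))); omega
          · refine .inr (.inr (.inr (.inr (.inr (.inr (.inr ?_)))))); omega
        · refine .inl (.inr (.inr (.inl ?_))); omega
        · refine .inr (.inr (.inr (.inr ?_)))
          have : j = 2 ∨ j = 6 := by omega
          rcases this with h'' | h''
          · refine .inl ?_
            omega
          · refine .inr (.inl ?_)
            omega
        · refine .inl (.inr (.inr (.inr ?_)))
          have : i = 2 ∨ i = 6 := by omega
          rcases this with h'' | h''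
          · refine .inl ?_
            omega
          · refine .inr (.inl ?_)
            omega
        · refine .inr (.inr (.inr (.inl ?_))); omega

lemma ncard_neighborSet_subdividedRel_zero (hq : 37 ≤ q) :
    ((valGraph q (SubdividedRel q)).neighborSet 0).ncard = 4 := by
  have : NeZero q := ⟨by omega⟩
  rw [ncard_neighborSet_of_val {1, q - 1, 4, q - 4}]
  · repeat rw [Finset.card_insert_of_notMem (by simp; omega)]
    simp
  · simp only [Finset.mem_insert, Finset.mem_singleton]
    omega
  · intro z
    have hzq := ZMod.val_lt z
    rw [valGraph_adj fun _ _ _ _ h ↦ SubdividedRel.lt hq h]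
    simp only [Finset.mem_insert, Finset.mem_singleton, SubdividedRel, ZMod.val_zero]
    constructor
    · rintro ((h | h | h | h | h | h | h) | (h | h | h | h | h | h | h)) <;> omega
    · rintro (h | h | h | h)
      · exact .inl (.inl h)
      · exact .inl (.inr (.inl ⟨trivial, h⟩))
      · exact .inl (.inr (.inr (.inr (.inr (.inr (.inl ⟨trivial, h⟩))))))
      · exact .inl (.inr (.inr (.inr (.inr (.inr (.inr ⟨trivial, h⟩))))))

/-- The integers that occur, up to sign and modulo `q`, as differences along the edges given by
`CycleRel q` and `SubdividedRel q`. -/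
def edgeDifferences : Finset ℤ := {1, 2, 4, 7, 8, -1, -2, -4, -7, -8}

lemma sub_mem_image_edgeDifferences [NeZero q] {R : ℕ → ℕ → Prop}
    (hR : ∀ i j, i < q → j < q → R i j → i < j)
    (hR' : ∀ i j, i < q → j < q → R i j →
      (j : ℤ) - i ∈ edgeDifferences ∨ (j : ℤ) - i - q ∈ edgeDifferences)
    {y z : ZMod q} (h : (valGraph q R).Adj y z) :
    y - z ∈ (Int.cast '' (edgeDifferences : Set ℤ) : Set (ZMod q)) := by
  have neg : ∀ t ∈ edgeDifferences, -t ∈ edgeDifferences := by decide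
  have key : ∀ y z : ZMod q, R y.val z.val → ∃ t ∈ edgeDifferences, (t : ZMod q) = z - y := by
    intro y z h
    rcases hR' _ _ (ZMod.val_lt y) (ZMod.val_lt z) h with h | h
    · exact ⟨_, h, by simp⟩
    · exact ⟨_, h, by simp⟩
  rcases (valGraph_adj hR).1 h with h | h
  · obtain ⟨t, ht, ht'⟩ := key _ _ h
    exact ⟨-t, neg t ht, by simp [ht']⟩
  · exact key _ _ h

lemma natCast_ne_zero_of_lt {a : ℕ} (ha : a ≠ 0) (h : a < q) : (a : ZMod q) ≠ 0 := by
  rw [ne_eq, ZMod.natCast_eq_zero_iff]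
  exact fun hd ↦ absurd (Nat.le_of_dvd (Nat.pos_of_ne_zero ha) hd) (by omega)

lemma inv_three_mul_notMem_image_edgeDifferences [Fact q.Prime] (hq : 37 ≤ q) {w : ZMod q}
    (hw : w ∈ (Int.cast '' (edgeDifferences : Set ℤ) : Set (ZMod q))) :
    3⁻¹ * w ∉ (Int.cast '' (edgeDifferences : Set ℤ) : Set (ZMod q)) := by
  have bound : ∀ t ∈ edgeDifferences, ∀ t' ∈ edgeDifferences,
      t - 3 * t' ≠ 0 ∧ |t - 3 * t'| < 37 := by decide
  obtain ⟨t, ht, rfl⟩ := hw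
  rintro ⟨t', ht', h⟩
  obtain ⟨h₁, h₂⟩ := bound t ht t' ht'
  have h3 : (3 : ZMod q) ≠ 0 :=
    mod_cast natCast_ne_zero_of_lt (a := 3) (by omega) (by omega)
  refine h₁ (Int.eq_zero_of_abs_lt_dvd (m := q) ?_ (h₂.trans_le (mod_cast hq)))
  rw [← ZMod.intCast_zmod_eq_zero_iff_dvd]
  push_cast
  rw [h]
  field_simp
  ring

end valGraph

theorem exists_regular_of_thirty_seven_le {q : ℕ} (hq : q.Prime) (hq' : 37 ≤ q) {u : ℕ}
    (hu : u ≤ q - 1) :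
    ∃ (V : Type) (G : SimpleGraph V), Finite V ∧
      (∀ v, (G.neighborSet v).ncard = q + 3 - u) ∧
      G.egirth = 5 ∧
      Nat.card V = 2 * (q * (q - u) - 1) := by
  have : Fact q.Prime := ⟨hq⟩
  have hodd : q % 2 = 1 := hq.eq_two_or_odd.resolve_left (by omega)
  have h3 : (3 : ZMod q) ≠ 0 :=
    mod_cast natCast_ne_zero_of_lt (a := 3) (by omega) (by omega)
  have hlt : ∀ i j, i < q → j < q → CycleRel q i j → i < j := fun _ _ _ _ h ↦ h.lt hq'
  have hlt' : ∀ i j, i < q → j < q → SubdividedRel q i j → i < j := fun _ _ _ _ h ↦ h.lt hq'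
  refine exists_regular_of_blocks hq (valGraph q (CycleRel q)) (valGraph q (SubdividedRel q)) 3⁻¹
    (Int.cast '' (edgeDifferences : Set ℤ)) (inv_ne_zero h3) (noShortCycle_cycleRel hq' hodd)
    (noShortCycle_subdividedRel hq' hodd) (fun y hy ↦ ?_)
    (fun y ↦ ncard_neighborSet_cycleRel hq' hodd)
    (fun y ↦ ncard_neighborSet_subdividedRel hq' hodd)
    (ncard_neighborSet_subdividedRel_zero hq')
    (fun y z ↦ sub_mem_image_edgeDifferences hlt fun i j hi hj h ↦ ?_)
    (fun y z ↦ sub_mem_image_edgeDifferences hlt' fun i j hi hj h ↦ ?_)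
    (fun w ↦ inv_three_mul_notMem_image_edgeDifferences hq')
    ⟨(q - 2 : ℕ), (q - 1 : ℕ), 1, ?_, ?_, ?_⟩ hu
  · have := ZMod.val_lt y
    rw [valGraph_adj hlt, ZMod.val_zero] at hy
    unfold CycleRel at hy
    omega
  · simp only [edgeDifferences, Finset.mem_insert, Finset.mem_singleton]
    unfold CycleRel at h
    omega
  · simp only [edgeDifferences, Finset.mem_insert, Finset.mem_singleton]
    unfold SubdividedRel at h
    omega
  · rw [valGraph_adj hlt, ZMod.val_natCast_of_lt (by omega), ZMod.val_natCast_of_lt (by omega)]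
    exact .inl (.inl ⟨by omega, by omega⟩)
  · rw [valGraph_adj hlt, ZMod.val_natCast_of_lt (by omega), ZMod.val_one]
    exact .inr (.inr (.inl ⟨rfl, rfl⟩))
  · have hval : (-(3⁻¹ * 1) + 1 : ZMod q).val = (-(3⁻¹ * 1) : ZMod q).val + 1 := by
      have hne : (-(3⁻¹ * 1) + 1 : ZMod q).val ≠ 0 := by
        rw [ne_eq, ZMod.val_eq_zero]
        intro h
        have h2 : (2 : ZMod q) ≠ 0 :=
          mod_cast natCast_ne_zero_of_lt (a := 2) (by omega) (by omega)
        apply h2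
        field_simp at h
        linear_combination h
      have := ZMod.val_lt (-(3⁻¹ * 1) : ZMod q)
      rw [ZMod.val_add, ZMod.val_one] at hne ⊢
      refine Nat.mod_eq_of_lt (lt_of_le_of_ne this fun h ↦ hne ?_)
      rw [h, Nat.mod_self]
    have h : -(3⁻¹ * ((q - 2 : ℕ) : ZMod q)) = -(3⁻¹ * 1) + 1 := by
      rw [Nat.cast_sub (by omega)]
      simp
      field_simp
      norm_num
    have hne : (-(3⁻¹ * 1) : ZMod q).val ≠ 0 := by
      simpa using h3
    rw [h, valGraph_adj hlt, hval]
    exact .inr (.inl ⟨by omega, rfl⟩)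

/-- For every prime `q = 6n + 1` with `n ≥ 2` and every `0 ≤ u ≤ q - 1`, there is a
`(q + 3 - u)`-regular graph of girth exactly `5` with `2 * (q * (q - u) - 1)` vertices. -/
theorem exists_regular_girth_five_6n1 (q n : ℕ) (hq : Nat.Prime q)
    (hqn : q = 6 * n + 1) (hn : 2 ≤ n) (u : ℕ) (hu : u ≤ q - 1) :
    ∃ (V : Type) (G : SimpleGraph V), Finite V ∧
      (∀ v, (G.neighborSet v).ncard = q + 3 - u) ∧
      G.egirth = 5 ∧
      Nat.card V = 2 * (q * (q - u) - 1) := by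
  by_cases h : 37 ≤ q
  · exact exists_regular_of_thirty_seven_le hq h hu
  · obtain rfl | rfl | rfl | rfl : n = 2 ∨ n = 3 ∨ n = 4 ∨ n = 5 := by omega
    · subst hqn
      exact exists_regular_of_eq_thirteen hu
    · subst hqn
      exact exists_regular_of_eq_nineteen hu
    · norm_num [hqn] at hq
    · subst hqn
      exact exists_regular_of_eq_thirty_one hu
end

section
/- For every natural number u with 0 ≤ u ≤ 18 there exists a finite simple graph which is (22 − u)-regular, has girth exactly 5, and has exactly 720 − 38u vertices. In particular there exists a 22-regular graph of girth 5 on 720 vertices and a 21-regular graph of girth 5 on 682 vertices. -/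
open SimpleGraph

namespace GirthFiveAmalgam

/-- Adjacency lists of four graphs on `ZMod 19`. The first argument selects the set of allowed
differences: `±1, ±2, ±3, ±4` for `false` and the other nonzero ones for `true`. If the second
argument is `true`, the graph is cubic on the nonzero elements; otherwise `0` has degree four and
all other vertices have degree three. -/
def adjLists : Bool → Bool → List (List (ZMod 19))
  | false, true =>
    [[], [2, 4, 17], [1, 3, 5], [2, 6, 18], [1, 6, 7], [2, 8, 9], [3, 4, 9], [4, 10, 11],
     [5, 11, 12], [5, 6, 10], [7, 9, 13], [7, 8, 14], [8, 13, 15], [10, 12, 16], [11, 15, 16],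
     [12, 14, 17], [13, 14, 18], [1, 15, 18], [3, 16, 17]]
  | false, false =>
    [[1, 4, 16, 17], [0, 2, 3], [1, 6, 18], [1, 5, 7], [0, 6, 7], [3, 6, 9], [2, 4, 5],
     [3, 4, 8], [7, 10, 11], [5, 11, 13], [8, 12, 14], [8, 9, 15], [10, 15, 16], [9, 14, 16],
     [10, 13, 17], [11, 12, 18], [0, 12, 13], [0, 14, 18], [2, 15, 17]]
  | true, true =>
    [[], [6, 11, 12], [7, 8, 13], [10, 12, 16], [10, 11, 14], [13, 15, 18], [1, 13, 14],
     [2, 15, 16], [2, 17, 18], [14, 15, 17], [3, 4, 17], [1, 4, 16], [1, 3, 18], [2, 5, 6],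
     [4, 6, 9], [5, 7, 9], [3, 7, 11], [8, 9, 10], [5, 8, 12]]
  | true, false =>
    [[5, 9, 12, 14], [6, 8, 15], [10, 11, 15], [8, 11, 12], [14, 16, 18], [0, 13, 15],
     [1, 11, 13], [13, 14, 17], [1, 3, 16], [0, 16, 17], [2, 17, 18], [2, 3, 6], [0, 3, 18],
     [5, 6, 7], [0, 4, 7], [1, 2, 5], [4, 8, 9], [7, 9, 10], [4, 10, 12]]

/-- The neighbours of `a` in the graph selected by `s` and `z`. -/
def nbrs (s z : Bool) (a : ZMod 19) : List (ZMod 19) :=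
  (adjLists s z).getD a.val []

lemma mem_nbrs_comm : ∀ {s z : Bool} {a b : ZMod 19}, a ∈ nbrs s z b → b ∈ nbrs s z a := by
  decide +kernel

lemma notMem_nbrs_self : ∀ (s z : Bool) (a : ZMod 19), a ∉ nbrs s z a := by
  decide +kernel

lemma nbrs_triangle_free :
    ∀ s z : Bool, ∀ a, ∀ b ∈ nbrs s z a, ∀ c ∈ nbrs s z b, c ∉ nbrs s z a := by
  decide +kernel

lemma nbrs_square_free :
    ∀ s z : Bool, ∀ a, ∀ b ∈ nbrs s z a, ∀ c ∈ nbrs s z b, c ≠ a →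
      ∀ d ∈ nbrs s z c, d ∈ nbrs s z a → b = d := by
  decide +kernel

lemma sub_mem_iff_of_mem_nbrs :
    ∀ s z : Bool, ∀ a, ∀ b ∈ nbrs s z a,
      (a - b ∈ [1, 2, 3, 4, -1, -2, -3, -4] ↔ s = false) := by
  decide +kernel

lemma sub_ne_sub_of_mem_nbrs {s t z w : Bool} (hst : s ≠ t) {a b c d : ZMod 19}
    (hab : b ∈ nbrs s z a) (hcd : d ∈ nbrs t w c) : a - b ≠ c - d := by
  intro h
  have h₁ := sub_mem_iff_of_mem_nbrs s z a b hab
  have h₂ := sub_mem_iff_of_mem_nbrs t w c d hcd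
  rw [h, h₂] at h₁
  cases s <;> cases t <;> simp_all

lemma zero_notMem_nbrs : ∀ (s : Bool) (a : ZMod 19), 0 ∉ nbrs s true a := by
  decide +kernel

lemma card_nbrs_true :
    ∀ (s : Bool) (a : ZMod 19), a ≠ 0 → (nbrs s true a).toFinset.card = 3 := by
  decide +kernel

lemma card_nbrs_false :
    ∀ (s : Bool) (a : ZMod 19), (nbrs s false a).toFinset.card = if a = 0 then 4 else 3 := by
  decide +kernel

/-- Adjacency in the amalgam of the point-line incidence graph `y + b = x * m` over `ZMod 19`
with the graphs `nbrs` placed on the classes of points and of lines. -/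
def Adjacent (p q : Bool × ZMod 19 × ZMod 19) : Prop :=
  (p.1 = q.1 ∧ p.2.1 = q.2.1 ∧ q.2.2 ∈ nbrs p.1 (decide (p.2.1 = 0)) p.2.2) ∨
    (p.1 ≠ q.1 ∧ p.2.2 + q.2.2 = p.2.1 * q.2.1)

/-- The amalgam graph on all points and lines. -/
def amalgam : SimpleGraph (Bool × ZMod 19 × ZMod 19) where
  Adj := Adjacent
  symm := ⟨by
    rintro ⟨s, x, y⟩ ⟨t, x', y'⟩ (⟨h₁, h₂, h₃⟩ | ⟨h₁, h₂⟩)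
    · dsimp only at h₁ h₂ h₃
      subst h₁ h₂
      exact Or.inl ⟨rfl, rfl, mem_nbrs_comm h₃⟩
    · exact Or.inr ⟨h₁.symm, by dsimp only at h₂ ⊢; rw [add_comm, h₂, mul_comm]⟩⟩
  loopless := ⟨by
    rintro ⟨s, x, y⟩ (⟨-, -, h⟩ | ⟨h, -⟩)
    · exact notMem_nbrs_self _ _ _ h
    · exact h rfl⟩

lemma amalgam_adj_same {s : Bool} {x y x' y' : ZMod 19} :
    amalgam.Adj (s, x, y) (s, x', y') ↔ x = x' ∧ y' ∈ nbrs s (decide (x = 0)) y := by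
  simp [amalgam, Adjacent]

lemma amalgam_adj_of_ne {s t : Bool} (hst : s ≠ t) {x y x' y' : ZMod 19} :
    amalgam.Adj (s, x, y) (t, x', y') ↔ y + y' = x * x' := by
  simp [amalgam, Adjacent, hst]

lemma amalgam_triangle_free {p q r : Bool × ZMod 19 × ZMod 19} (hpq : amalgam.Adj p q)
    (hqr : amalgam.Adj q r) (hrp : amalgam.Adj r p) : False := by
  have mixed : ∀ {s t : Bool} {x y x' y' x'' y'' : ZMod 19}, s ≠ t →
      amalgam.Adj (s, x, y) (s, x', y') → amalgam.Adj (s, x', y') (t, x'', y'') →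
      amalgam.Adj (t, x'', y'') (s, x, y) → False := by
    intro s t x y x' y' x'' y'' hst h₁ h₂ h₃
    rw [amalgam_adj_same] at h₁
    rw [amalgam_adj_of_ne hst] at h₂
    rw [amalgam_adj_of_ne hst.symm] at h₃
    obtain ⟨rfl, h₁⟩ := h₁
    have : y = y' := by linear_combination h₃ - h₂
    exact notMem_nbrs_self _ _ _ (this ▸ h₁)
  obtain ⟨s, x, y⟩ := p
  obtain ⟨t, x', y'⟩ := q
  obtain ⟨v, x'', y''⟩ := r
  by_cases hst : s = t
  · subst hst
    by_cases hsv : s = v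
    · subst hsv
      rw [amalgam_adj_same] at hpq hqr hrp
      obtain ⟨rfl, h₁⟩ := hpq
      obtain ⟨rfl, h₂⟩ := hqr
      exact nbrs_triangle_free _ _ _ _ h₁ _ h₂ (mem_nbrs_comm hrp.2)
    · exact mixed hsv hpq hqr hrp
  · by_cases hsv : s = v
    · subst hsv
      exact mixed hst hrp hpq hqr
    · obtain rfl : t = v := by cases s <;> cases t <;> cases v <;> simp_all
      exact mixed (Ne.symm hst) hqr hrp hpq

lemma amalgam_square_free {p q r w : Bool × ZMod 19 × ZMod 19} (hpq : amalgam.Adj p q)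
    (hqr : amalgam.Adj q r) (hrw : amalgam.Adj r w) (hwp : amalgam.Adj w p)
    (hpr : p ≠ r) (hqw : q ≠ w) : False := by
  have three : ∀ {p q r w : Bool × ZMod 19 × ZMod 19}, p.1 = q.1 → q.1 = r.1 → r.1 ≠ w.1 →
      amalgam.Adj p q → amalgam.Adj q r → amalgam.Adj r w → amalgam.Adj w p → p = r := by
    rintro ⟨s, x, y⟩ ⟨_, x', y'⟩ ⟨_, x'', y''⟩ ⟨t, m, b⟩ ⟨⟩ ⟨⟩ hst h₁ h₂ h₃ h₄
    rw [amalgam_adj_same] at h₁ h₂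
    rw [amalgam_adj_of_ne hst] at h₃
    rw [amalgam_adj_of_ne hst.symm] at h₄
    obtain ⟨rfl, -⟩ := h₁
    obtain ⟨rfl, -⟩ := h₂
    have : y = y'' := by linear_combination h₄ - h₃
    rw [this]
  have consecutive : ∀ {p q r w : Bool × ZMod 19 × ZMod 19}, p.1 = q.1 → q.1 ≠ r.1 → r.1 = w.1 →
      amalgam.Adj p q → amalgam.Adj q r → amalgam.Adj r w → amalgam.Adj w p → False := by
    rintro ⟨s, x, y⟩ ⟨_, x', y'⟩ ⟨t, m, b⟩ ⟨_, m', b'⟩ ⟨⟩ hst ⟨⟩ h₁ h₂ h₃ h₄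
    dsimp only at hst
    rw [amalgam_adj_same] at h₁ h₃
    rw [amalgam_adj_of_ne hst] at h₂
    rw [amalgam_adj_of_ne hst.symm] at h₄
    obtain ⟨rfl, h₁⟩ := h₁
    obtain ⟨rfl, h₃⟩ := h₃
    exact sub_ne_sub_of_mem_nbrs hst h₁ h₃ (by linear_combination h₄ - h₂)
  have alternating : ∀ {p q r w : Bool × ZMod 19 × ZMod 19}, p.1 ≠ q.1 → p.1 = r.1 → q.1 = w.1 →
      amalgam.Adj p q → amalgam.Adj q r → amalgam.Adj r w → amalgam.Adj w p → p = r ∨ q = w := by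
    rintro ⟨s, x, y⟩ ⟨t, m, b⟩ ⟨_, x', y'⟩ ⟨_, m', b'⟩ hst ⟨⟩ ⟨⟩ h₁ h₂ h₃ h₄
    dsimp only at hst
    rw [amalgam_adj_of_ne hst] at h₁ h₃
    rw [amalgam_adj_of_ne hst.symm] at h₂ h₄
    have : Fact (Nat.Prime 19) := ⟨by norm_num⟩
    have key : (x - x') * (m - m') = 0 := by linear_combination h₂ + h₄ - h₁ - h₃
    rcases mul_eq_zero.1 key with h | h
    · left
      obtain rfl := sub_eq_zero.1 h
      have : y = y' := by linear_combination h₁ - h₂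
      rw [this]
    · right
      obtain rfl := sub_eq_zero.1 h
      have : b = b' := by linear_combination h₁ - h₄
      rw [this]
  have eq : ∀ {a b c : Bool}, a ≠ b → b ≠ c → a = c := by decide
  by_cases h₁ : p.1 = q.1 <;> by_cases h₂ : q.1 = r.1 <;> by_cases h₃ : r.1 = w.1
  · obtain ⟨s, x, y⟩ := p
    obtain ⟨_, x', y'⟩ := q
    obtain ⟨_, x'', y''⟩ := r
    obtain ⟨_, x''', y'''⟩ := w
    cases h₁
    cases h₂
    cases h₃
    rw [amalgam_adj_same] at hpq hqr hrw hwp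
    obtain ⟨rfl, e₁⟩ := hpq
    obtain ⟨rfl, e₂⟩ := hqr
    obtain ⟨rfl, e₃⟩ := hrw
    have := nbrs_square_free _ _ _ _ e₁ _ e₂ (fun h => hpr (by rw [h])) _ e₃
      (mem_nbrs_comm hwp.2)
    exact hqw (by rw [this])
  · exact hpr (three h₁ h₂ h₃ hpq hqr hrw hwp)
  · exact consecutive h₁ h₂ h₃ hpq hqr hrw hwp
  · exact hqw (three (h₁.trans (eq h₂ h₃)).symm h₁ h₂ hwp hpq hqr hrw).symm
  · exact hqw (three h₂ h₃ (fun h => h₁ (h₂.trans (h₃.trans h)).symm) hqr hrw hwp hpq)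
  · exact consecutive h₂ h₃ (eq h₁ fun h => h₃ (h₂.symm.trans h)).symm hqr hrw hwp hpq
  · exact hpr (three h₃ ((eq h₁ h₂).trans h₃).symm h₁ hrw hwp hpq hqr).symm
  · rcases alternating h₁ (eq h₁ h₂) (eq h₂ h₃) hpq hqr hrw hwp with h | h
    exacts [hpr h, hqw h]

lemma five_le_egirth_of_square_free {V : Type*} {G : SimpleGraph V}
    (h3 : ∀ {p q r}, G.Adj p q → G.Adj q r → G.Adj r p → False)
    (h4 : ∀ {p q r w}, G.Adj p q → G.Adj q r → G.Adj r w → G.Adj w p → p ≠ r → q ≠ w → False) :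
    5 ≤ G.egirth := by
  rw [le_egirth]
  intro a w hw
  by_contra! hlt
  have hlt : w.length < 5 := by exact_mod_cast hlt
  have hnodup := hw.support_nodup
  match w, hw.three_le_length, hlt with
  | .cons e₁ (.cons e₂ (.cons e₃ .nil)), _, _ => exact h3 e₁ e₂ e₃
  | .cons e₁ (.cons e₂ (.cons e₃ (.cons e₄ .nil))), _, _ =>
    simp only [Walk.support_cons, Walk.support_nil, List.tail_cons, List.nodup_cons,
      List.mem_cons] at hnodup
    exact h4 e₁ e₂ e₃ e₄ (by grind) (by grind)

lemma five_le_egirth_amalgam : 5 ≤ amalgam.egirth :=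
  five_le_egirth_of_square_free amalgam_triangle_free amalgam_square_free

lemma card_filter_val_lt {n : ℕ} (hn : n ≤ 19) :
    (Finset.univ.filter fun x : ZMod 19 => x.val < n).card = n := by
  interval_cases n <;> decide +kernel

/-- The points and lines in the first `n` classes, without the point and the line `(0, 0)`. -/
def vertices (n : ℕ) : Finset (Bool × ZMod 19 × ZMod 19) :=
  Finset.univ ×ˢ (((Finset.univ.filter fun x : ZMod 19 => x.val < n) ×ˢ Finset.univ).erase (0, 0))

lemma mem_vertices {n : ℕ} {s : Bool} {x y : ZMod 19} :
    (s, x, y) ∈ vertices n ↔ x.val < n ∧ ¬(x = 0 ∧ y = 0) := by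
  simp [vertices, and_comm]

lemma card_vertices {n : ℕ} (hn : n ≤ 19) (h0 : 0 < n) :
    (vertices n).card = 2 * (n * 19 - 1) := by
  rw [vertices, Finset.card_product, Finset.card_erase_of_mem (by simpa using h0),
    Finset.card_product, card_filter_val_lt hn]
  simp [ZMod.card]

/-- The amalgam graph restricted to the first `n` classes, without `(0, 0)` on either side. -/
abbrev reduced (n : ℕ) : SimpleGraph (vertices n) :=
  amalgam.comap Subtype.val

lemma egirth_reduced {n : ℕ} (h0 : 0 < n) : (reduced n).egirth = 5 := by
  apply le_antisymm
  · have mem : ∀ y : ZMod 19, y ≠ 0 → (false, 0, y) ∈ vertices n := fun y hy => by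
      simp [mem_vertices, h0, hy]
    have adj : ∀ {y y' : ZMod 19} (hy : y ≠ 0) (hy' : y' ≠ 0), y' ∈ nbrs false true y →
        (reduced n).Adj ⟨_, mem y hy⟩ ⟨_, mem y' hy'⟩ := fun hy hy' h =>
      amalgam_adj_same.2 ⟨rfl, by simpa using h⟩
    have n1 : (1 : ZMod 19) ≠ 0 := by decide
    have n2 : (2 : ZMod 19) ≠ 0 := by decide
    have n3 : (3 : ZMod 19) ≠ 0 := by decide
    have n6 : (6 : ZMod 19) ≠ 0 := by decide
    have n4 : (4 : ZMod 19) ≠ 0 := by decide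
    let w : (reduced n).Walk ⟨_, mem 1 n1⟩ ⟨_, mem 1 n1⟩ :=
      .cons (adj n1 n2 (by decide +kernel)) <| .cons (adj n2 n3 (by decide +kernel)) <|
      .cons (adj n3 n6 (by decide +kernel)) <| .cons (adj n6 n4 (by decide +kernel)) <|
      .cons (adj n4 n1 (by decide +kernel)) .nil
    have hw : w.IsCycle := by
      rw [Walk.isCycle_iff_isPath_tail_and_le_length]
      refine ⟨?_, by simp [w]⟩
      rw [Walk.isPath_def]
      simp [w]
      decide +kernel
    exact egirth_le_length hw
  · exact five_le_egirth_of_square_free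
      (fun h₁ h₂ h₃ => amalgam_triangle_free h₁ h₂ h₃)
      (fun h₁ h₂ h₃ h₄ hpr hqw => amalgam_square_free h₁ h₂ h₃ h₄
        (Subtype.val_injective.ne hpr) (Subtype.val_injective.ne hqw))

lemma ncard_neighborSet_reduced {n : ℕ} (hn : n ≤ 19) (h0 : 0 < n) (v : vertices n) :
    ((reduced n).neighborSet v).ncard = n + 3 := by
  obtain ⟨⟨s, x, y⟩, hv⟩ := v
  rw [← Set.ncard_image_of_injective _ Subtype.val_injective]
  have hset : Subtype.val '' (reduced n).neighborSet ⟨(s, x, y), hv⟩ =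
      ↑(((nbrs s (decide (x = 0)) y).toFinset.image fun b => (s, x, b)) ∪
        ((Finset.univ.filter fun m : ZMod 19 => m.val < n).filter fun m =>
          ¬(m = 0 ∧ y = 0)).image fun m => (!s, m, x * m - y)) := by
    ext ⟨t, m, b⟩
    have hv' := mem_vertices.1 hv
    by_cases hst : s = t
    · subst hst
      simp only [Set.mem_image, mem_neighborSet, comap_adj, Subtype.exists, exists_and_right,
        exists_eq_right, amalgam_adj_same, mem_vertices, Finset.coe_union, Set.mem_union,
        Finset.mem_coe, Finset.mem_image, List.mem_toFinset, Prod.mk.injEq]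
      constructor
      · rintro ⟨⟨-, rfl⟩, h⟩
        exact Or.inl ⟨b, h, trivial, rfl, rfl⟩
      · rintro (⟨b, h, -, rfl, rfl⟩ | ⟨m, -, h, -⟩)
        · refine ⟨⟨⟨hv'.1, ?_⟩, rfl⟩, h⟩
          rintro ⟨rfl, rfl⟩
          exact zero_notMem_nbrs _ _ (by simpa using h)
        · simp at h
    · obtain rfl : t = !s := by cases s <;> cases t <;> simp_all
      simp only [Set.mem_image, mem_neighborSet, comap_adj, Subtype.exists, exists_and_right,
        exists_eq_right, amalgam_adj_of_ne hst, mem_vertices, Finset.coe_union, Set.mem_union,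
        Finset.mem_coe, Finset.mem_image, Finset.mem_filter, Finset.mem_univ, true_and,
        List.mem_toFinset, Prod.mk.injEq]
      constructor
      · rintro ⟨⟨h₁, h₂⟩, h⟩
        refine Or.inr ⟨m, ⟨h₁, ?_⟩, rfl, by linear_combination -h⟩
        rintro ⟨rfl, rfl⟩
        exact h₂ ⟨rfl, by linear_combination h⟩
      · rintro (⟨b, -, h, -⟩ | ⟨m, ⟨h₁, h₂⟩, rfl, rfl⟩)
        · exact absurd h hst
        · refine ⟨⟨h₁, ?_⟩, by ring⟩
          rintro ⟨rfl, h⟩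
          exact h₂ ⟨rfl, by linear_combination -h⟩
  rw [hset, Set.ncard_coe_finset, Finset.card_union_of_disjoint,
    Finset.card_image_of_injective _ (fun a b h => by simpa using h),
    Finset.card_image_of_injective _ (fun a b h => (Prod.mk.inj (Prod.mk.inj h).2).1)]
  · have hv' := mem_vertices.1 hv
    by_cases hx : x = 0
    · have hy : y ≠ 0 := fun hy => hv'.2 ⟨hx, hy⟩
      simp [hx, hy, card_nbrs_true, card_filter_val_lt hn, add_comm]
    · by_cases hy : y = 0
      · have : ((Finset.univ.filter fun m : ZMod 19 => m.val < n).filter fun m =>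
            ¬(m = 0 ∧ y = 0)) = (Finset.univ.filter fun m : ZMod 19 => m.val < n).erase 0 := by
          ext m
          simp [hy, and_comm]
        rw [this, Finset.card_erase_of_mem (by simpa using h0), card_filter_val_lt hn]
        simp only [hx, decide_false, card_nbrs_false, hy, if_true]
        omega
      · simp [hx, hy, card_nbrs_false, card_filter_val_lt hn, add_comm]
  · rw [Finset.disjoint_left]
    simp only [Finset.mem_image, not_exists, not_and]
    rintro _ ⟨b, -, rfl⟩ m - h
    simp at h

lemma exists_regular_girth_five (u : ℕ) (hu : u ≤ 18) :
    ∃ (V : Type) (G : SimpleGraph V), Finite V ∧ (∀ v, (G.neighborSet v).ncard = 22 - u) ∧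
      G.egirth = 5 ∧ Nat.card V = 720 - 38 * u := by
  refine ⟨vertices (19 - u), reduced (19 - u), inferInstance, fun v => ?_,
    egirth_reduced (by omega), ?_⟩
  · rw [ncard_neighborSet_reduced (by omega) (by omega)]
    omega
  · rw [Nat.card_eq_fintype_card, Fintype.card_coe, card_vertices (by omega) (by omega)]
    omega

end GirthFiveAmalgam

/-- For every `0 ≤ u ≤ 18` there is a `(22 - u)`-regular graph of girth exactly `5`
on `720 - 38u` vertices; in particular there is a `22`-regular graph of girth `5` on
`720` vertices and a `21`-regular graph of girth `5` on `682` vertices. -/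
theorem exists_regular_girth_five_q19 :
    (∀ u : ℕ, u ≤ 18 →
      ∃ (V : Type) (G : SimpleGraph V), Finite V ∧
        (∀ v, (G.neighborSet v).ncard = 22 - u) ∧
        G.egirth = 5 ∧
        Nat.card V = 720 - 38 * u) ∧
    (∃ (V : Type) (G : SimpleGraph V), Finite V ∧
      (∀ v, (G.neighborSet v).ncard = 22) ∧
      G.egirth = 5 ∧
      Nat.card V = 720) ∧
    (∃ (V : Type) (G : SimpleGraph V), Finite V ∧
      (∀ v, (G.neighborSet v).ncard = 21) ∧
      G.egirth = 5 ∧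
      Nat.card V = 682) :=
  ⟨GirthFiveAmalgam.exists_regular_girth_five,
    GirthFiveAmalgam.exists_regular_girth_five 0 (by norm_num),
    GirthFiveAmalgam.exists_regular_girth_five 1 (by norm_num)⟩
end

section
/- For every natural number u with 0 ≤ u ≤ 10 there exists a finite simple graph which is (13 − u)-regular, has girth exactly 5, and has exactly 236 − 22u vertices. In particular there exists a 13-regular graph of girth 5 on 236 vertices. -/
open SimpleGraph

namespace GirthFive

/-- Vertices of the ambient graph: points `(true, x, y)` and lines `(false, m, b)` of the elliptic
semiplane of type C over `ZMod 11`. A point and a line are incident when `y + b = x * m`. -/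
abbrev Vertex : Type := Bool × ZMod 11 × ZMod 11

/-- The labels deleted from the class with index `0` on each side. -/
def removed : Bool → List (ZMod 11)
  | true => [0, 4]
  | false => [0, 1, 3, 7]

/-- The edges added inside a class; the flag says whether the index of the class is `0`. -/
def blockEdges : Bool → Bool → List (ZMod 11 × ZMod 11)
  | true, false => [(0, 1), (0, 2), (0, 3), (1, 4), (2, 10), (3, 5), (4, 7), (4, 6), (5, 8),
      (6, 8), (7, 9), (8, 10), (9, 10)]
  | false, false => [(0, 4), (0, 5), (0, 6), (1, 8), (1, 7), (2, 7), (2, 9), (3, 7), (3, 10),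
      (4, 8), (5, 9), (6, 10)]
  | true, true => [(1, 2), (1, 3), (2, 10), (3, 5), (5, 8), (6, 7), (6, 8), (7, 9), (8, 10),
      (9, 10)]
  | false, true => [(2, 8), (2, 6), (4, 8), (4, 9), (5, 9), (5, 10), (6, 10)]

/-- Adjacency of two labels inside a class. -/
abbrev BlockAdj (s z : Bool) (a b : ZMod 11) : Prop :=
  (a, b) ∈ blockEdges s z ∨ (b, a) ∈ blockEdges s z

/-- The differences of labels that may occur along an edge inside a class of points. -/
def pointDifferences : List (ZMod 11) := [1, 2, 3, 8, 9, 10]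

lemma blockAdj_symm {s z : Bool} {a b : ZMod 11} (h : BlockAdj s z a b) : BlockAdj s z b a :=
  Or.symm h

lemma not_blockAdj_self : ∀ (s z : Bool) (a : ZMod 11), ¬ BlockAdj s z a a := by decide +kernel

lemma blockAdj_difference :
    ∀ (s z : Bool) (a b : ZMod 11), BlockAdj s z a b → (a - b ∈ pointDifferences ↔ s = true) := by
  decide +kernel

lemma blockAdj_sub_ne {s t : Bool} (hst : s ≠ t) {z z' : Bool} {a b c d : ZMod 11}
    (h : BlockAdj s z a b) (h' : BlockAdj t z' c d) : a - b ≠ c - d := by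
  intro e
  have h₁ := blockAdj_difference s z a b h
  have h₂ := blockAdj_difference t z' c d h'
  rw [e, h₂] at h₁
  cases s <;> cases t <;> simp_all

lemma blockAdj_no_triangle : ∀ (s z : Bool) (a b : ZMod 11), BlockAdj s z a b →
    ∀ c, BlockAdj s z b c → ¬ BlockAdj s z c a := by
  decide +kernel

set_option synthInstance.maxSize 1000 in
lemma blockAdj_common_neighbor_unique : ∀ (s z : Bool) (a b : ZMod 11), BlockAdj s z a b →
    ∀ c, BlockAdj s z b c → a ≠ c → ∀ d, BlockAdj s z c d → BlockAdj s z d a → b = d := by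
  decide +kernel

/-- The incidence graph of the semiplane with the extra edges inside the classes. -/
def ambient : SimpleGraph Vertex where
  Adj v w := (v.1 = w.1 ∧ v.2.1 = w.2.1 ∧ BlockAdj v.1 (decide (v.2.1 = 0)) v.2.2 w.2.2) ∨
    (v.1 ≠ w.1 ∧ v.2.2 + w.2.2 = v.2.1 * w.2.1)
  symm := ⟨by
    rintro ⟨s, i, a⟩ ⟨t, j, b⟩ (⟨h₁, h₂, h₃⟩ | ⟨h₁, h₂⟩)
    · dsimp only at h₁ h₂ h₃
      subst h₁ h₂
      exact Or.inl ⟨rfl, rfl, blockAdj_symm h₃⟩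
    · exact Or.inr ⟨h₁.symm, by rw [add_comm, mul_comm]; exact h₂⟩⟩
  loopless := ⟨by
    rintro ⟨s, i, a⟩ (⟨-, -, h⟩ | ⟨h, -⟩)
    · exact not_blockAdj_self _ _ _ h
    · exact h rfl⟩

lemma ambient_adj_same {s : Bool} {i j a b : ZMod 11} :
    ambient.Adj (s, i, a) (s, j, b) ↔ i = j ∧ BlockAdj s (decide (i = 0)) a b := by
  simp [ambient]

lemma ambient_adj_of_ne {s t : Bool} (h : s ≠ t) {i j a b : ZMod 11} :
    ambient.Adj (s, i, a) (t, j, b) ↔ a + b = i * j := by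
  simp [ambient, h]

instance : Fact (Nat.Prime 11) := ⟨by norm_num⟩

/-- Two vertices of one class have no common neighbor on the other side. -/
lemma eq_of_adj_of_adj {s t : Bool} (h : s ≠ t) {i j a b c : ZMod 11}
    (h₁ : ambient.Adj (s, i, a) (t, j, c)) (h₂ : ambient.Adj (s, i, b) (t, j, c)) : a = b := by
  rw [ambient_adj_of_ne h] at h₁ h₂
  linear_combination h₁ - h₂

lemma ambient_no_triangle_of_same {s t : Bool} {i j k a b c : ZMod 11}
    (hab : ambient.Adj (s, i, a) (s, j, b)) (hbc : ambient.Adj (s, j, b) (t, k, c)) :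
    ¬ ambient.Adj (t, k, c) (s, i, a) := by
  intro hca
  obtain ⟨rfl, h⟩ := ambient_adj_same.1 hab
  by_cases hst : s = t
  · subst hst
    obtain ⟨rfl, h'⟩ := ambient_adj_same.1 hbc
    exact blockAdj_no_triangle _ _ _ _ h _ h' (ambient_adj_same.1 hca).2
  · obtain rfl := eq_of_adj_of_adj hst hbc hca.symm
    exact hab.ne rfl

lemma ambient_no_triangle {u v w : Vertex} (huv : ambient.Adj u v) (hvw : ambient.Adj v w) :
    ¬ ambient.Adj w u := by
  intro hwu
  obtain ⟨s, i, a⟩ := u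
  obtain ⟨t, j, b⟩ := v
  obtain ⟨r, k, c⟩ := w
  have hs : s = t ∨ t = r ∨ r = s := by cases s <;> cases t <;> cases r <;> simp
  rcases hs with rfl | rfl | rfl
  · exact ambient_no_triangle_of_same huv hvw hwu
  · exact ambient_no_triangle_of_same hvw hwu huv
  · exact ambient_no_triangle_of_same hwu huv hvw

lemma ambient_common_neighbor_unique_of_same {s t r : Bool} {i j k l a b c d : ZMod 11}
    (hab : ambient.Adj (s, i, a) (s, j, b)) (hbc : ambient.Adj (s, j, b) (t, k, c))
    (hcd : ambient.Adj (t, k, c) (r, l, d)) (hda : ambient.Adj (r, l, d) (s, i, a))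
    (hac : ((s, i, a) : Vertex) ≠ (t, k, c)) : ((s, j, b) : Vertex) = (r, l, d) := by
  obtain ⟨rfl, h⟩ := ambient_adj_same.1 hab
  by_cases hst : s = t
  · subst hst
    obtain ⟨rfl, h'⟩ := ambient_adj_same.1 hbc
    by_cases hsr : s = r
    · subst hsr
      obtain ⟨rfl, h''⟩ := ambient_adj_same.1 hcd
      rw [blockAdj_common_neighbor_unique _ _ _ _ h _ h' (fun e => hac (by rw [e])) _ h''
        (ambient_adj_same.1 hda).2]
    · exact absurd (by rw [eq_of_adj_of_adj hsr hda.symm hcd]) hac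
  · by_cases hsr : s = r
    · subst hsr
      obtain ⟨rfl, -⟩ := ambient_adj_same.1 hda
      rw [eq_of_adj_of_adj hst hbc hcd.symm]
    · obtain rfl : t = r := by cases s <;> cases t <;> cases r <;> simp_all
      obtain ⟨rfl, h'⟩ := ambient_adj_same.1 hcd
      rw [ambient_adj_of_ne hst] at hbc
      rw [ambient_adj_of_ne (Ne.symm hst)] at hda
      exact absurd (by linear_combination hda - hbc) (blockAdj_sub_ne hst h h')

lemma ambient_common_neighbor_unique {u v w x : Vertex} (huv : ambient.Adj u v)
    (hvw : ambient.Adj v w) (hwx : ambient.Adj w x) (hxu : ambient.Adj x u) (huw : u ≠ w) :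
    v = x := by
  by_contra hvx
  obtain ⟨s, i, a⟩ := u
  obtain ⟨t, j, b⟩ := v
  obtain ⟨r, k, c⟩ := w
  obtain ⟨q, l, d⟩ := x
  have hs : s = t ∨ t = r ∨ r = q ∨ q = s ∨ (s = r ∧ t = q ∧ s ≠ t) := by
    cases s <;> cases t <;> cases r <;> cases q <;> simp
  rcases hs with rfl | rfl | rfl | rfl | ⟨rfl, rfl, hst⟩
  · exact hvx (ambient_common_neighbor_unique_of_same huv hvw hwx hxu huw)
  · exact huw (ambient_common_neighbor_unique_of_same hvw hwx hxu huv hvx).symm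
  · exact hvx (ambient_common_neighbor_unique_of_same hwx hxu huv hvw huw.symm).symm
  · exact huw (ambient_common_neighbor_unique_of_same hxu huv hvw hwx (Ne.symm hvx))
  · rw [ambient_adj_of_ne hst] at huv hwx
    rw [ambient_adj_of_ne (Ne.symm hst)] at hvw hxu
    have h : (i - k) * (j - l) = 0 := by linear_combination hvw + hxu - huv - hwx
    rcases mul_eq_zero.1 h with h | h
    · obtain rfl := sub_eq_zero.1 h
      exact huw (by rw [show a = c by linear_combination huv - hvw])
    · obtain rfl := sub_eq_zero.1 h
      exact hvx (by rw [show b = d by linear_combination huv - hxu])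

lemma five_le_egirth_of_embedding {V : Type*} {G : SimpleGraph V} (f : G ↪g ambient) :
    5 ≤ G.egirth := by
  rw [le_egirth]
  intro a w hw
  have h₃ := hw.three_le_length
  by_contra! h₅
  have h₅ : w.length < 5 := by exact_mod_cast h₅
  match w, hw, h₃, h₅ with
  | .cons p (.cons q (.cons r .nil)), _, _, _ =>
    exact ambient_no_triangle (f.map_adj_iff.2 p) (f.map_adj_iff.2 q) (f.map_adj_iff.2 r)
  | .cons (v := b) p (.cons (v := c) q (.cons (v := d) r (.cons s .nil))), hw, _, _ =>
    have hnodup := hw.support_nodup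
    simp only [Walk.support_cons, Walk.support_nil, List.tail_cons, List.nodup_cons,
      List.mem_cons, not_or] at hnodup
    exact hnodup.1.2.1 (f.injective (ambient_common_neighbor_unique (f.map_adj_iff.2 p)
      (f.map_adj_iff.2 q) (f.map_adj_iff.2 r) (f.map_adj_iff.2 s)
      (fun e => hnodup.2.1.2.1 (f.injective e).symm)))
  | .cons _ (.cons _ (.cons _ (.cons _ (.cons _ _)))), _, _, h => simp at h; omega

/-- The vertices that remain after deleting the last `u` classes on each side and the `removed`
labels in the classes with index `0`. -/
abbrev Alive (u : ℕ) (v : Vertex) : Prop :=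
  v.2.1.val + u ≤ 10 ∧ (v.2.1 = 0 → v.2.2 ∉ removed v.1)

lemma alive_of_blockAdj_zero : ∀ (s : Bool) (a b : ZMod 11), BlockAdj s true a b →
    b ∉ removed s := by
  decide +kernel

/-- The subgraph of `ambient` on the vertices that are `Alive`. -/
def graph (u : ℕ) : SimpleGraph {v // Alive u v} :=
  ambient.comap Subtype.val

lemma card_opposite_add_card_block : ∀ u : Fin 11, ∀ (s z : Bool) (a : ZMod 11),
    (z = true → a ∉ removed s) →
    (Finset.univ.filter fun j : ZMod 11 =>
      j.val + u.val ≤ 10 ∧ (j = 0 → -a ∉ removed !s)).card +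
    (Finset.univ.filter fun b : ZMod 11 => BlockAdj s z a b).card = 13 - u.val := by
  decide +kernel

lemma ncard_neighborSet_graph (u : ℕ) (hu : u ≤ 10) (v : {v // Alive u v}) :
    ((graph u).neighborSet v).ncard = 13 - u := by
  obtain ⟨⟨s, i, a⟩, hi, ha⟩ := v
  dsimp only at hi ha
  rw [← card_opposite_add_card_block ⟨u, by omega⟩ s (decide (i = 0)) a (by simpa using ha),
    ← Set.ncard_image_of_injective _ Subtype.val_injective]
  have hf : Function.Injective fun j : ZMod 11 => ((!s, j, i * j - a) : Vertex) := by
    intro j k h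
    simp only [Prod.mk.injEq] at h
    exact h.2.1
  have hg : Function.Injective fun b : ZMod 11 => ((s, i, b) : Vertex) := by
    intro j k h
    simp only [Prod.mk.injEq] at h
    exact h.2.2
  rw [← Finset.card_image_of_injective _ hf, ← Finset.card_image_of_injective _ hg,
    ← Finset.card_union_of_disjoint, ← Set.ncard_coe_finset]
  · congr 1
    ext ⟨t, j, b⟩
    simp only [Set.mem_image, mem_neighborSet, graph, comap_adj, Subtype.exists, Finset.coe_union,
      Finset.coe_image, Finset.coe_filter, Finset.mem_univ, true_and, Set.mem_union,
      Set.mem_ofPred_eq, exists_and_right, exists_eq_right, Prod.mk.injEq]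
    by_cases hst : s = t
    · subst hst
      simp only [ambient_adj_same]
      constructor
      · rintro ⟨-, rfl, h⟩
        exact Or.inr ⟨b, h, by simp⟩
      · rintro (⟨_, _, h, _⟩ | ⟨c, h, -, rfl, rfl⟩)
        · simp at h
        · refine ⟨⟨hi, fun h₀ => ?_⟩, rfl, h⟩
          dsimp only at h₀ ⊢
          exact alive_of_blockAdj_zero s a c (by simpa [h₀] using h)
    · obtain rfl : t = !s := by cases s <;> cases t <;> simp_all
      simp only [ambient_adj_of_ne hst]
      constructor
      · rintro ⟨⟨h₁, h₂⟩, h⟩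
        dsimp only at h₁ h₂
        refine Or.inl ⟨j, ⟨h₁, fun h₀ => ?_⟩, by simp [← h]⟩
        have hb : b = -a := by rw [h₀] at h; linear_combination h
        exact hb ▸ h₂ h₀
      · rintro (⟨k, ⟨h₁, h₂⟩, -, rfl, rfl⟩ | ⟨_, _, h, _⟩)
        · refine ⟨⟨h₁, fun h₀ => ?_⟩, by ring⟩
          dsimp only at h₀ ⊢
          simpa [h₀] using h₂ h₀
        · exact absurd h hst
  · rw [Finset.disjoint_left]
    intro x h₁ h₂
    obtain ⟨j, -, rfl⟩ := Finset.mem_image.1 h₁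
    obtain ⟨b, -, h⟩ := Finset.mem_image.1 h₂
    simp at h

lemma egirth_graph (u : ℕ) (hu : u ≤ 10) : (graph u).egirth = 5 := by
  refine le_antisymm ?_ (five_le_egirth_of_embedding (Embedding.comap (.subtype _) ambient))
  let vertex (y : ZMod 11) (hy : y ∉ removed true) : {v // Alive u v} :=
    ⟨(true, 0, y), by simpa using hu, fun _ => hy⟩
  have adj {y z : ZMod 11} (hy : y ∉ removed true) (hz : z ∉ removed true)
      (h : BlockAdj true true y z) : (graph u).Adj (vertex y hy) (vertex z hz) :=
    ambient_adj_same.2 ⟨rfl, h⟩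
  let w : (graph u).Walk (vertex 6 (by decide)) (vertex 6 (by decide)) :=
    .cons (adj (z := 7) (by decide) (by decide) (by decide)) <|
    .cons (adj (z := 9) (by decide) (by decide) (by decide)) <|
    .cons (adj (z := 10) (by decide) (by decide) (by decide)) <|
    .cons (adj (z := 8) (by decide) (by decide) (by decide)) <|
    .cons (adj (z := 6) (by decide) (by decide) (by decide)) .nil
  have hinj {y z : ZMod 11} (hy : y ∉ removed true) (hz : z ∉ removed true) :
      vertex y hy = vertex z hz ↔ y = z := by
    simp [vertex]
  have hw : w.IsCycle := by
    simp only [w, Walk.cons_isCycle_iff, Walk.isPath_def, Walk.support_cons, Walk.support_nil,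
      Walk.edges_cons, Walk.edges_nil, List.nodup_cons, List.mem_cons, Sym2.eq_iff, hinj]
    simp only [List.not_mem_nil, List.nodup_nil]
    decide
  exact egirth_le_length hw

lemma card_alive : ∀ u : Fin 11,
    (Finset.univ.filter fun v : Vertex => Alive u.val v).card = 236 - 22 * u.val := by
  decide +kernel

end GirthFive

/-- For every `0 ≤ u ≤ 10` there is a `(13 - u)`-regular graph of girth exactly `5`
on `236 - 22u` vertices; in particular there is a `13`-regular graph of girth `5` on
`236` vertices. -/
theorem exists_regular_girth_five_q11 :
    (∀ u : ℕ, u ≤ 10 →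
      ∃ (V : Type) (G : SimpleGraph V), Finite V ∧
        (∀ v, (G.neighborSet v).ncard = 13 - u) ∧
        G.egirth = 5 ∧
        Nat.card V = 236 - 22 * u) ∧
    (∃ (V : Type) (G : SimpleGraph V), Finite V ∧
      (∀ v, (G.neighborSet v).ncard = 13) ∧
      G.egirth = 5 ∧
      Nat.card V = 236) := by
  have main : ∀ u : ℕ, u ≤ 10 →
      ∃ (V : Type) (G : SimpleGraph V), Finite V ∧
        (∀ v, (G.neighborSet v).ncard = 13 - u) ∧
        G.egirth = 5 ∧
        Nat.card V = 236 - 22 * u := fun u hu =>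
    ⟨{v // GirthFive.Alive u v}, GirthFive.graph u, inferInstance,
      GirthFive.ncard_neighborSet_graph u hu, GirthFive.egirth_graph u hu, by
        rw [Nat.card_eq_fintype_card, Fintype.card_subtype]
        exact GirthFive.card_alive ⟨u, by omega⟩⟩
  exact ⟨main, by simpa using main 0 (by norm_num)⟩
end

section
/- For every natural number u with 0 ≤ u ≤ 16 there exists a finite simple graph which is (20 − u)-regular, has girth exactly 5, and has exactly 572 − 34u vertices. In particular there exists a 20-regular graph of girth 5 on 572 vertices. -/
open SimpleGraph

namespace GirthFiveSeventeen

/-- In the incidence graph of the biaffine plane over `ZMod 17`, the vertex `(true, x, y)` is a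
point and `(false, m, b)` is a line; they are incident when `y + b = x * m`. -/
abbrev Vertex : Type := Bool × ZMod 17 × ZMod 17

/-- Adjacency lists of the graphs amalgamated into the blocks of the incidence graph. The first
argument selects points or lines, the second one says whether the block has index `0`. -/
def blockTable : Bool → Bool → List (List (ZMod 17))
  | true, true =>
    [[], [], [3, 4, 15], [2, 5, 6], [2, 7, 8], [3, 8, 9], [3, 7, 10], [4, 6, 11], [4, 5, 12],
     [5, 11, 13], [6, 12, 14], [7, 9, 14], [8, 10, 13], [9, 12, 15], [10, 11, 15], [2, 13, 14],
     []]
  | true, false =>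
    [[3, 4, 14, 16], [2, 4, 5, 15], [1, 6, 16], [0, 5, 6], [0, 1, 7], [1, 3, 8], [2, 3, 9], [4,
     8, 10], [5, 7, 12], [6, 11, 13], [7, 11, 14], [9, 10, 12], [8, 11, 16], [9, 15, 16], [0,
     10, 15], [1, 13, 14], [0, 2, 12, 13]]
  | false, true =>
    [[], [], [7, 8, 12], [8, 10, 11], [9, 11, 13], [10, 12, 13], [11, 12, 14], [2, 13, 15], [2,
     3, 14], [4, 14, 15], [3, 5, 15], [3, 4, 6], [2, 5, 6], [4, 5, 7], [6, 8, 9], [7, 9, 10],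
     []]
  | false, false =>
    [[5, 6, 10, 11], [7, 8, 11, 12], [8, 13, 14], [9, 11, 14], [10, 12, 16], [0, 14, 16], [0,
     12, 13], [1, 13, 16], [1, 2, 15], [3, 15, 16], [0, 4, 15], [0, 1, 3], [1, 4, 6], [2, 6, 7],
     [2, 3, 5], [8, 9, 10], [4, 5, 7, 9]]

/-- The neighbours of `y` in the graph amalgamated into a block. -/
def blockNeighbors (s z : Bool) (y : ZMod 17) : Finset (ZMod 17) :=
  ((blockTable s z).getD y.val []).toFinset

/-- The second coordinates of the vertices deleted from the two blocks of index `0`. -/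
def deleted : Finset (ZMod 17) := {-1, 0, 1}

/-- The differences along edges amalgamated into point blocks. -/
def pointWeights : Finset (ZMod 17) := {1, 2, 3, 4, -1, -2, -3, -4}

instance : Fact (Nat.Prime 17) := ⟨by norm_num⟩

theorem blockNeighbors_symm : ∀ s z y, ∀ y' ∈ blockNeighbors s z y,
    y ∈ blockNeighbors s z y' := by
  decide +kernel

theorem notMem_blockNeighbors_self : ∀ s z y, y ∉ blockNeighbors s z y := by
  decide +kernel

theorem blockNeighbors_triangle_free : ∀ s z a, ∀ b ∈ blockNeighbors s z a,
    ∀ c ∈ blockNeighbors s z b, c ∉ blockNeighbors s z a := by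
  decide +kernel

theorem blockNeighbors_inter_subsingleton : ∀ s z a, ∀ b ∈ blockNeighbors s z a,
    ∀ c ∈ blockNeighbors s z b, ∀ d ∈ blockNeighbors s z a,
      c ∈ blockNeighbors s z d → a = c ∨ b = d := by
  decide +kernel

theorem sub_mem_pointWeights_iff : ∀ s z y, ∀ y' ∈ blockNeighbors s z y,
    (y' - y ∈ pointWeights ↔ s = true) := by
  decide +kernel

theorem notMem_deleted_of_mem_blockNeighbors : ∀ s y, ∀ y' ∈ blockNeighbors s true y,
    y' ∉ deleted := by
  decide +kernel

theorem neg_mem_deleted_iff : ∀ y, -y ∈ deleted ↔ y ∈ deleted := by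
  decide +kernel

theorem card_blockNeighbors : ∀ s z y, (z = true → y ∉ deleted) →
    (blockNeighbors s z y).card = if y ∈ deleted then 4 else 3 := by
  decide +kernel

/-- The amalgamated incidence graph. -/
def amalgam : SimpleGraph Vertex where
  Adj v w := (v.1 = w.1 ∧ v.2.1 = w.2.1 ∧ w.2.2 ∈ blockNeighbors v.1 (v.2.1 = 0) v.2.2) ∨
    (v.1 ≠ w.1 ∧ v.2.2 + w.2.2 = v.2.1 * w.2.1)
  symm := ⟨by
    rintro ⟨s, x, y⟩ ⟨s', x', y'⟩ (⟨rfl, rfl, h⟩ | ⟨h, h'⟩)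
    · exact Or.inl ⟨rfl, rfl, blockNeighbors_symm _ _ _ _ h⟩
    · exact Or.inr ⟨h.symm, by rw [add_comm, h', mul_comm]⟩⟩
  loopless := ⟨by
    rintro ⟨s, x, y⟩ (⟨-, -, h⟩ | ⟨h, -⟩)
    · exact notMem_blockNeighbors_self _ _ _ h
    · exact h rfl⟩

theorem amalgam_adj_same {s : Bool} {x y x' y' : ZMod 17} :
    amalgam.Adj (s, x, y) (s, x', y') ↔ x = x' ∧ y' ∈ blockNeighbors s (x = 0) y := by
  simp [amalgam]

theorem amalgam_adj_not {s : Bool} {x y x' y' : ZMod 17} :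
    amalgam.Adj (s, x, y) (!s, x', y') ↔ y + y' = x * x' := by
  simp [amalgam]

/-- Every block contains at most one neighbour of a vertex of the opposite side. -/
theorem amalgam_eq_of_adj_not {s : Bool} {x y y' m b : ZMod 17}
    (h : amalgam.Adj (s, x, y) (!s, m, b)) (h' : amalgam.Adj (s, x, y') (!s, m, b)) :
    y = y' := by
  rw [amalgam_adj_not] at h h'
  exact add_right_cancel (h.trans h'.symm)

/-- Edges amalgamated into blocks of opposite sides do not lie in a common quadrangle. -/
theorem amalgam_parallel_edges {s : Bool} {x y y' m b b' : ZMod 17}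
    (h : y' ∈ blockNeighbors s (x = 0) y) (h' : b' ∈ blockNeighbors (!s) (m = 0) b)
    (e : y + b' = x * m) (e' : y' + b = x * m) : False := by
  have h₁ := sub_mem_pointWeights_iff _ _ _ _ h
  have h₂ := sub_mem_pointWeights_iff _ _ _ _ h'
  have h₃ : y' - y = b' - b := by linear_combination e' - e
  rw [h₃, h₂] at h₁
  cases s <;> simp at h₁

theorem amalgam_triangle_free {a b c : Vertex} (hab : amalgam.Adj a b) (hbc : amalgam.Adj b c)
    (hac : amalgam.Adj a c) : False := by
  obtain ⟨s, xa, ya⟩ := a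
  obtain ⟨sb, xb, yb⟩ := b
  obtain ⟨sc, xc, yc⟩ := c
  obtain hb | hb := Bool.eq_or_eq_not sb s <;> obtain hc | hc := Bool.eq_or_eq_not sc s <;>
    subst hb hc
  · obtain ⟨rfl, h₁⟩ := amalgam_adj_same.1 hab
    obtain ⟨rfl, h₂⟩ := amalgam_adj_same.1 hbc
    exact blockNeighbors_triangle_free _ _ _ _ h₁ _ h₂ (amalgam_adj_same.1 hac).2
  · obtain ⟨rfl, h₁⟩ := amalgam_adj_same.1 hab
    obtain rfl := amalgam_eq_of_adj_not hac hbc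
    exact notMem_blockNeighbors_self _ _ _ h₁
  · obtain ⟨rfl, h₁⟩ := amalgam_adj_same.1 hac
    obtain rfl := amalgam_eq_of_adj_not hab hbc.symm
    exact notMem_blockNeighbors_self _ _ _ h₁
  · obtain ⟨rfl, h₁⟩ := amalgam_adj_same.1 hbc
    rw [amalgam_adj_not] at hab hac
    obtain rfl := add_left_cancel (hab.trans hac.symm)
    exact notMem_blockNeighbors_self _ _ _ h₁

theorem amalgam_common_neighbor_unique {a b c d : Vertex} (hab : amalgam.Adj a b)
    (hcb : amalgam.Adj c b) (had : amalgam.Adj a d) (hcd : amalgam.Adj c d) :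
    a = c ∨ b = d := by
  obtain ⟨s, xa, ya⟩ := a
  obtain ⟨sb, xb, yb⟩ := b
  obtain ⟨sc, xc, yc⟩ := c
  obtain ⟨sd, xd, yd⟩ := d
  obtain hb | hb := Bool.eq_or_eq_not sb s <;> obtain hc | hc := Bool.eq_or_eq_not sc s <;>
    obtain hd | hd := Bool.eq_or_eq_not sd s <;> subst hb hc hd
  · obtain ⟨rfl, h₁⟩ := amalgam_adj_same.1 hab
    obtain ⟨rfl, h₂⟩ := amalgam_adj_same.1 hcb.symm
    obtain ⟨rfl, h₃⟩ := amalgam_adj_same.1 had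
    obtain ⟨-, h₄⟩ := amalgam_adj_same.1 hcd.symm
    simpa using blockNeighbors_inter_subsingleton _ _ _ _ h₁ _ h₂ _ h₃ h₄
  · obtain ⟨rfl, -⟩ := amalgam_adj_same.1 hab
    obtain ⟨rfl, -⟩ := amalgam_adj_same.1 hcb
    obtain rfl := amalgam_eq_of_adj_not had hcd
    exact Or.inl rfl
  · obtain ⟨rfl, -⟩ := amalgam_adj_same.1 hab
    obtain ⟨rfl, -⟩ := amalgam_adj_same.1 had
    obtain rfl := amalgam_eq_of_adj_not hcb.symm hcd.symm
    exact Or.inr rfl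
  · obtain ⟨rfl, h₁⟩ := amalgam_adj_same.1 hab
    obtain ⟨rfl, h₂⟩ := amalgam_adj_same.1 hcd
    exact (amalgam_parallel_edges h₁ h₂ (amalgam_adj_not.1 had)
      (amalgam_adj_not.1 hcb.symm)).elim
  · obtain ⟨rfl, -⟩ := amalgam_adj_same.1 had
    obtain ⟨rfl, -⟩ := amalgam_adj_same.1 hcd
    obtain rfl := amalgam_eq_of_adj_not hab hcb
    exact Or.inl rfl
  · rw [amalgam_adj_not] at hab hcb had hcd
    have h : (xa - xc) * (xb - xd) = 0 := by linear_combination hcb + had - hab - hcd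
    rcases mul_eq_zero.1 h with h | h
    · obtain rfl := sub_eq_zero.1 h
      obtain rfl := add_right_cancel (hab.trans hcb.symm)
      exact Or.inl rfl
    · obtain rfl := sub_eq_zero.1 h
      obtain rfl := add_left_cancel (hab.trans had.symm)
      exact Or.inr rfl
  · obtain ⟨rfl, h₁⟩ := amalgam_adj_same.1 had
    obtain ⟨rfl, h₂⟩ := amalgam_adj_same.1 hcb
    exact (amalgam_parallel_edges h₁ h₂ (amalgam_adj_not.1 hab)
      (amalgam_adj_not.1 hcd.symm)).elim
  · obtain ⟨rfl, -⟩ := amalgam_adj_same.1 hcb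
    obtain ⟨rfl, -⟩ := amalgam_adj_same.1 hcd
    rw [amalgam_adj_not] at hab had
    obtain rfl := add_left_cancel (hab.trans had.symm)
    exact Or.inr rfl

theorem five_le_egirth {V : Type*} {G : SimpleGraph V}
    (h₃ : ∀ a b c, G.Adj a b → G.Adj b c → G.Adj a c → False)
    (h₄ : ∀ a b c d, G.Adj a b → G.Adj c b → G.Adj a d → G.Adj c d → a = c ∨ b = d) :
    5 ≤ G.egirth := by
  refine le_egirth.2 fun a w hw => ?_
  by_contra! hlt
  have hlen : w.length < 5 := by exact_mod_cast hlt
  have hthree := hw.three_le_length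
  have hnodup := hw.support_nodup
  match w with
  | .nil => simp at hthree
  | .cons _ .nil => simp at hthree
  | .cons _ (.cons _ .nil) => simp at hthree
  | .cons hab (.cons hbc (.cons hca .nil)) => exact h₃ _ _ _ hab hbc hca.symm
  | .cons hab (.cons hbc (.cons hcd (.cons hda .nil))) =>
    rcases h₄ _ _ _ _ hab hbc.symm hda.symm hcd with h | h <;> simp_all
  | .cons _ (.cons _ (.cons _ (.cons _ (.cons _ _)))) => simp at hlen; omega

/-- The vertices whose block index is less than `n`, without the deleted ones. -/
def vertices (n : ℕ) : Finset Vertex :=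
  Finset.univ.filter fun v => v.2.1.val < n ∧ (v.2.1 = 0 → v.2.2 ∉ deleted)

theorem mem_vertices {n : ℕ} {s : Bool} {x y : ZMod 17} :
    (s, x, y) ∈ vertices n ↔ x.val < n ∧ (x = 0 → y ∉ deleted) := by
  simp [vertices]

theorem card_vertices : ∀ n ∈ Finset.Icc 1 17, (vertices n).card = 34 * n - 6 := by
  decide +kernel

theorem card_filter_val_lt : ∀ n ∈ Finset.Icc 1 17, ∀ y : ZMod 17,
    (Finset.univ.filter fun x : ZMod 17 => x.val < n ∧ (x = 0 → y ∉ deleted)).card =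
      if y ∈ deleted then n - 1 else n := by
  decide +kernel

/-- The amalgamated graph on the first `n` blocks of points and of lines. -/
abbrev truncatedAmalgam (n : ℕ) : SimpleGraph (vertices n) :=
  amalgam.induce (vertices n : Set Vertex)

theorem truncatedAmalgam_regular {n : ℕ} (hn : n ∈ Finset.Icc 1 17) (v : vertices n) :
    ((truncatedAmalgam n).neighborSet v).ncard = n + 3 := by
  obtain ⟨⟨s, x, y⟩, hv⟩ := v
  have hxy := mem_vertices.1 hv
  have himage : Subtype.val '' (truncatedAmalgam n).neighborSet ⟨(s, x, y), hv⟩ =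
      ((blockNeighbors s (x = 0) y).image (fun y' => (s, x, y')) ∪
        (Finset.univ.filter fun m : ZMod 17 => m.val < n ∧ (m = 0 → y ∉ deleted)).image
          (fun m => (!s, m, x * m - y)) : Finset Vertex) := by
    ext ⟨s', x', y'⟩
    obtain hs | hs := Bool.eq_or_eq_not s' s <;> subst hs
    · simp [amalgam_adj_same, mem_vertices]
      constructor
      · rintro ⟨⟨rfl, h⟩, -⟩
        exact ⟨h, rfl⟩
      · rintro ⟨h, rfl⟩
        refine ⟨⟨rfl, h⟩, hxy.1, ?_⟩
        rintro rfl
        exact notMem_deleted_of_mem_blockNeighbors _ _ _ (by simpa using h)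
    · simp [amalgam_adj_not, mem_vertices]
      constructor
      · rintro ⟨h, hm, hd⟩
        have hy : y' = x * x' - y := by linear_combination h
        refine ⟨⟨hm, ?_⟩, hy.symm⟩
        rintro rfl
        simpa [hy, neg_mem_deleted_iff] using hd rfl
      · rintro ⟨⟨hm, hd⟩, rfl⟩
        refine ⟨by ring, hm, ?_⟩
        rintro rfl
        simpa [neg_mem_deleted_iff] using hd rfl
  rw [← Set.ncard_image_of_injective _ Subtype.val_injective, himage, Set.ncard_coe_finset,
    Finset.card_union_of_disjoint, Finset.card_image_of_injective, Finset.card_image_of_injective,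
    card_blockNeighbors _ _ _ (by simpa using hxy.2), card_filter_val_lt n hn]
  · rw [Finset.mem_Icc] at hn
    split_ifs <;> omega
  · intro m m' h
    exact congrArg (fun v : Vertex => v.2.1) h
  · intro y₁ y₂ h
    exact congrArg (fun v : Vertex => v.2.2) h
  · simp [Finset.disjoint_left]

theorem truncatedAmalgam_egirth {n : ℕ} (hn : n ∈ Finset.Icc 1 17) :
    (truncatedAmalgam n).egirth = 5 := by
  refine le_antisymm ?_ (five_le_egirth (fun a b c hab hbc hac => ?_)
    (fun a b c d hab hcb had hcd => ?_))
  · rw [Finset.mem_Icc] at hn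
    have hmem : ∀ y : ZMod 17, y ∉ deleted → (true, 0, y) ∈ vertices n := fun y hy =>
      mem_vertices.2 ⟨hn.1, fun _ => hy⟩
    let v (y : {y : ZMod 17 // y ∉ deleted}) : vertices n := ⟨(true, 0, y), hmem y y.2⟩
    have hadj : ∀ y y' : {y : ZMod 17 // y ∉ deleted}, y'.1 ∈ blockNeighbors true true y →
        (truncatedAmalgam n).Adj (v y) (v y') := fun y y' h =>
      amalgam_adj_same.2 ⟨rfl, by simpa using h⟩
    let w : (truncatedAmalgam n).Walk (v ⟨2, by decide⟩) (v ⟨2, by decide⟩) :=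
      .cons (hadj _ ⟨3, by decide⟩ (by decide)) <| .cons (hadj _ ⟨6, by decide⟩ (by decide)) <|
      .cons (hadj _ ⟨7, by decide⟩ (by decide)) <| .cons (hadj _ ⟨4, by decide⟩ (by decide)) <|
      .cons (hadj _ ⟨2, by decide⟩ (by decide)) .nil
    have hw : w.IsCycle := by
      have hv : Function.Injective v := fun y y' h =>
        Subtype.ext (congrArg (fun u : vertices n => u.1.2.2) h)
      rw [Walk.isCycle_def, Walk.isTrail_def]
      refine ⟨?_, by simp [w], ?_⟩
      · simp [w, hv.eq_iff]
        decide
      · simp [w, hv.eq_iff]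
        decide
    exact egirth_le_length hw
  · exact amalgam_triangle_free hab hbc hac
  · exact (amalgam_common_neighbor_unique hab hcb had hcd).imp Subtype.ext Subtype.ext

end GirthFiveSeventeen

open GirthFiveSeventeen in
/-- For every `0 ≤ u ≤ 16` there is a `(20 - u)`-regular graph of girth exactly `5`
on `572 - 34u` vertices; in particular there is a `20`-regular graph of girth `5` on
`572` vertices. -/
theorem exists_regular_girth_five_q17 :
    (∀ u : ℕ, u ≤ 16 →
      ∃ (V : Type) (G : SimpleGraph V), Finite V ∧
        (∀ v, (G.neighborSet v).ncard = 20 - u) ∧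
        G.egirth = 5 ∧
        Nat.card V = 572 - 34 * u) ∧
    (∃ (V : Type) (G : SimpleGraph V), Finite V ∧
      (∀ v, (G.neighborSet v).ncard = 20) ∧
      G.egirth = 5 ∧
      Nat.card V = 572) := by
  have key : ∀ u : ℕ, u ≤ 16 →
      ∃ (V : Type) (G : SimpleGraph V), Finite V ∧
        (∀ v, (G.neighborSet v).ncard = 20 - u) ∧
        G.egirth = 5 ∧
        Nat.card V = 572 - 34 * u := by
    intro u hu
    have hn : 17 - u ∈ Finset.Icc 1 17 := by
      rw [Finset.mem_Icc]
      omega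
    refine ⟨vertices (17 - u), truncatedAmalgam (17 - u), inferInstance, fun v => ?_,
      truncatedAmalgam_egirth hn, ?_⟩
    · rw [truncatedAmalgam_regular hn]
      omega
    · rw [Nat.card_eq_fintype_card, Fintype.card_coe, card_vertices _ hn]
      omega
  exact ⟨key, key 0 (Nat.zero_le _)⟩
end
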